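/- arXiv:2109.11601 — 7 statements merged into one kernel-verified Lean document; each statement's English description precedes it below -/
import Mathlib

section
/- Let X be a nonempty compact Hausdorff topological space equipped with its Borel σ-algebra, let S be a nonempty set of continuous maps X → X closed under composition, and let σ be a regular Borel probability measure on X. Suppose there exists a mean F on S such that for every h ∈ S and every continuous function φ : X → ℝ one has F(g ↦ ∫ φ(h(g x)) dσ(x)) = F(g ↦ ∫ φ(g x) dσ(x)). Then there exists a regular Borel probability measure μ on X that is invariant under every element of S, i.e. μ(f⁻¹(A)) = μ(A) for every f ∈ S and every Borel set A ⊆ X. -/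
/-- A real-valued function on `σ` is bounded. -/
def Bdd {σ : Type*} (f : σ → ℝ) : Prop := ∃ C : ℝ, ∀ s, |f s| ≤ C

/-- A mean on `σ`: a normalized positive real-linear functional on the space `ℓ∞(σ)`
of bounded real-valued functions on `σ`. -/
structure Mean (σ : Type*) where
  toFun : (σ → ℝ) → ℝ
  map_add' : ∀ f g : σ → ℝ, Bdd f → Bdd g → toFun (f + g) = toFun f + toFun g
  map_smul' : ∀ (c : ℝ) (f : σ → ℝ), Bdd f → toFun (c • f) = c * toFun f
  nonneg' : ∀ f : σ → ℝ, Bdd f → (∀ s, 0 ≤ f s) → 0 ≤ toFun f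
  one' : toFun (fun _ => (1 : ℝ)) = 1

open MeasureTheory

namespace Mean

open scoped CompactlySupported

/-- The orbit integrals of a continuous function on a compact space are uniformly bounded. -/
lemma bdd_integral_comp {X : Type*} [TopologicalSpace X] [CompactSpace X] [MeasurableSpace X]
    (S : Set (X → X)) (σ : Measure X) [IsProbabilityMeasure σ] (φ : C(X, ℝ)) :
    Bdd (fun g : S => ∫ x, φ ((g : X → X) x) ∂σ) := by
  refine ⟨‖φ‖, fun g => ?_⟩
  simpa using norm_integral_le_of_norm_le_const (μ := σ) (C := ‖φ‖)
    (Filter.Eventually.of_forall fun x => φ.norm_coe_le_norm ((g : X → X) x))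

/-- The positive linear functional `φ ↦ F (g ↦ ∫ φ ∘ g dσ)` on continuous functions. -/
noncomputable def averagedIntegral {X : Type*} [TopologicalSpace X] [CompactSpace X]
    [MeasurableSpace X] [BorelSpace X] {S : Set (X → X)} (F : Mean S)
    (hcont : ∀ f ∈ S, Continuous f) (σ : Measure X) [IsProbabilityMeasure σ] : C_c(X, ℝ) →ₚ[ℝ] ℝ :=
  PositiveLinearMap.mk₀
    { toFun := fun φ => F.toFun (fun g : S => ∫ x, φ ((g : X → X) x) ∂σ)
      map_add' := fun φ ψ => by
        refine Eq.trans ?_ (F.map_add' _ _ (bdd_integral_comp S σ φ.1) (bdd_integral_comp S σ ψ.1))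
        congr 1
        ext g
        have integrable_comp (φ : C_c(X, ℝ)) : Integrable (fun x => φ ((g : X → X) x)) σ :=
          (φ.continuous.comp (hcont g g.2)).integrable_of_hasCompactSupport
            (HasCompactSupport.of_compactSpace _)
        exact integral_add (integrable_comp φ) (integrable_comp ψ)
      map_smul' := fun c φ => by
        refine Eq.trans ?_ (F.map_smul' c _ (bdd_integral_comp S σ φ.1))
        congr 1
        ext g
        exact integral_const_mul c _ }
    fun φ hφ => F.nonneg' _ (bdd_integral_comp S σ φ.1) fun _ => integral_nonneg fun _ => hφ _

end Mean

/-- A finite regular measure on a compact Hausdorff space is invariant under a continuous map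
as soon as integrals of continuous functions are. -/
lemma measurePreserving_of_integral_comp_eq {X : Type*} [TopologicalSpace X] [CompactSpace X]
    [T2Space X] [MeasurableSpace X] [BorelSpace X] {μ : Measure X} [IsFiniteMeasure μ] [μ.Regular]
    {f : X → X} (hf : Continuous f) (h : ∀ φ : C(X, ℝ), ∫ x, φ (f x) ∂μ = ∫ x, φ x ∂μ) :
    MeasurePreserving f μ μ := by
  refine ⟨hf.measurable, ?_⟩
  have : μ.InnerRegular := inferInstance
  have : (μ.map f).InnerRegular := Measure.InnerRegular.map_of_continuous hf
  have : (μ.map f).Regular := inferInstance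
  refine Measure.ext_of_integral_eq_on_compactlySupported fun φ => ?_
  exact (integral_map hf.aemeasurable φ.continuous.aestronglyMeasurable).trans <|
    h φ.toContinuousMap

/-- A semigroup of continuous self-maps of a nonempty compact Hausdorff space whose
Koopman (anti-)representation is left amenable with respect to a regular Borel
probability measure `σ` admits a common invariant regular Borel probability measure. -/
theorem left_amenable_koopman_invariant_measure
    {X : Type*} [TopologicalSpace X] [CompactSpace X] [T2Space X] [Nonempty X]
    [MeasurableSpace X] [BorelSpace X]
    (S : Set (X → X)) (hne : S.Nonempty) (hcont : ∀ f ∈ S, Continuous f)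
    (hcomp : ∀ f ∈ S, ∀ g ∈ S, f ∘ g ∈ S)
    (σ : Measure X) [IsProbabilityMeasure σ] [σ.Regular]
    (F : Mean S)
    (hF : ∀ (h : S) (φ : C(X, ℝ)),
      F.toFun (fun g : S => ∫ x, φ ((h : X → X) ((g : X → X) x)) ∂σ) =
        F.toFun (fun g : S => ∫ x, φ ((g : X → X) x) ∂σ)) :
    ∃ μ : Measure X, IsProbabilityMeasure μ ∧ μ.Regular ∧
      ∀ f ∈ S, ∀ A : Set X, MeasurableSet A → μ (f ⁻¹' A) = μ A := by
  let μ := RealRMK.rieszMeasure (F.averagedIntegral hcont σ)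
  have hμ (φ : C(X, ℝ)) :
      ∫ x, φ x ∂μ = F.toFun (fun g : S => ∫ x, φ ((g : X → X) x) ∂σ) :=
    RealRMK.integral_rieszMeasure (F.averagedIntegral hcont σ)
      ⟨φ, HasCompactSupport.of_compactSpace _⟩
  refine ⟨μ, ?_, inferInstance, fun f hf A hA => ?_⟩
  · have h1 := hμ 1
    simp only [ContinuousMap.one_apply, integral_const, probReal_univ, smul_eq_mul, mul_one,
      F.one'] at h1
    exact isProbabilityMeasure_iff_real.2 h1
  · refine (measurePreserving_of_integral_comp_eq (hcont f hf) fun φ => ?_).measure_preimage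
      hA.nullMeasurableSet
    exact (hμ (φ.comp ⟨f, hcont f hf⟩)).trans ((hF ⟨f, hf⟩ φ).trans (hμ φ).symm)
end

section
/- Let X be a nonempty compact Hausdorff topological space equipped with its Borel σ-algebra and let S be a nonempty set of continuous maps X → X closed under composition. If S is left amenable, then there exists a regular Borel probability measure μ on X that is invariant under every element of S, i.e. μ(f⁻¹(A)) = μ(A) for every f ∈ S and every Borel set A ⊆ X. (In particular, a left amenable semigroup of rational maps of the Riemann sphere admits a common invariant probability measure.) -/
/-- `M` is a left invariant mean on a set `S` of self-maps of `α`, regarded as a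
semigroup with product `g·h := g ∘ h`:  `M (g ↦ f (h ∘ g)) = M f` for all `h ∈ S`
and all bounded `f`. -/
def MapLeftInv {α : Type*} (S : Set (α → α)) (M : Mean S) : Prop :=
  ∀ (h : S) (hc : ∀ g : S, (h : α → α) ∘ (g : α → α) ∈ S),
    ∀ f : S → ℝ, Bdd f →
      M.toFun (fun g : S => f ⟨(h : α → α) ∘ (g : α → α), hc g⟩) = M.toFun f

/-- `M` is a right invariant mean on a set `S` of self-maps of `α` under composition:
`M (g ↦ f (g ∘ h)) = M f` for all `h ∈ S` and all bounded `f`. -/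
def MapRightInv {α : Type*} (S : Set (α → α)) (M : Mean S) : Prop :=
  ∀ (h : S) (hc : ∀ g : S, (g : α → α) ∘ (h : α → α) ∈ S),
    ∀ f : S → ℝ, Bdd f →
      M.toFun (fun g : S => f ⟨(g : α → α) ∘ (h : α → α), hc g⟩) = M.toFun f

open MeasureTheory

open scoped CompactlySupported

theorem bdd_comp_of_compactSpace {σ X : Type*} [TopologicalSpace X] [CompactSpace X]
    {f : X → ℝ} (hf : Continuous f) (φ : σ → X) : Bdd fun s => f (φ s) := by
  obtain ⟨C, hC⟩ := isCompact_univ.exists_bound_of_continuousOn hf.continuousOn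
  exact ⟨C, fun s => hC (φ s) (Set.mem_univ _)⟩

/-- The positive linear functional on continuous functions obtained by averaging along a map
into a compact space with respect to a mean. -/
noncomputable def Mean.pushforward {σ X : Type*} [TopologicalSpace X] [CompactSpace X]
    (M : Mean σ) (φ : σ → X) : C_c(X, ℝ) →ₚ[ℝ] ℝ :=
  PositiveLinearMap.mk₀
    { toFun := fun f => M.toFun fun s => f (φ s)
      map_add' := fun f g => M.map_add' _ _
        (bdd_comp_of_compactSpace f.continuous φ) (bdd_comp_of_compactSpace g.continuous φ)
      map_smul' := fun c f => M.map_smul' c _ (bdd_comp_of_compactSpace f.continuous φ) }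
    fun f hf => M.nonneg' _ (bdd_comp_of_compactSpace f.continuous φ) fun s => hf (φ s)

/-- Every mean is represented, along a map into a compact Hausdorff space, by a regular Borel
probability measure. -/
theorem Mean.exists_regular_isProbabilityMeasure {σ X : Type*} [TopologicalSpace X]
    [CompactSpace X] [T2Space X] [MeasurableSpace X] [BorelSpace X] (M : Mean σ) (φ : σ → X) :
    ∃ μ : Measure X, IsProbabilityMeasure μ ∧ μ.Regular ∧
      ∀ f : X → ℝ, Continuous f → ∫ x, f x ∂μ = M.toFun fun s => f (φ s) := by
  have key (f : X → ℝ) (hf : Continuous f) :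
      ∫ x, f x ∂(RealRMK.rieszMeasure (M.pushforward φ)) = M.toFun fun s => f (φ s) :=
    RealRMK.integral_rieszMeasure (M.pushforward φ)
      ⟨⟨f, hf⟩, HasCompactSupport.of_compactSpace _⟩
  refine ⟨RealRMK.rieszMeasure (M.pushforward φ), ?_, by infer_instance, key⟩
  have h := key (fun _ => 1) continuous_const
  rw [M.one', integral_const, smul_eq_mul, mul_one] at h
  exact isProbabilityMeasure_iff_real.mpr h

/-- A left amenable semigroup of continuous self-maps of a nonempty compact Hausdorff
space admits a common invariant regular Borel probability measure. -/
theorem left_amenable_invariant_measure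
    {X : Type*} [TopologicalSpace X] [CompactSpace X] [T2Space X] [Nonempty X]
    [MeasurableSpace X] [BorelSpace X]
    (S : Set (X → X)) (hne : S.Nonempty) (hcont : ∀ f ∈ S, Continuous f)
    (hcomp : ∀ f ∈ S, ∀ g ∈ S, f ∘ g ∈ S)
    (hLA : ∃ M : Mean S, MapLeftInv S M) :
    ∃ μ : Measure X, IsProbabilityMeasure μ ∧ μ.Regular ∧
      ∀ f ∈ S, ∀ A : Set X, MeasurableSet A → μ (f ⁻¹' A) = μ A := by
  obtain ⟨M, hM⟩ := hLA
  obtain ⟨x₀⟩ := ‹Nonempty X›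
  obtain ⟨μ, hprob, hreg, hint⟩ :=
    M.exists_regular_isProbabilityMeasure fun g : S => (g : X → X) x₀
  refine ⟨μ, hprob, hreg, fun f hf A hA => ?_⟩
  have hfc := hcont f hf
  have : (μ.map f).InnerRegularCompactLTTop :=
    Measure.InnerRegularCompactLTTop.map_of_continuous hfc
  have hmap : μ.map f = μ := by
    refine Measure.ext_of_integral_eq_on_compactlySupported fun k => ?_
    have hk : Continuous (k : X → ℝ) := k.continuous
    rw [integral_map hfc.aemeasurable hk.aestronglyMeasurable,
      hint (fun x => k (f x)) (hk.comp hfc), hint k hk]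
    exact hM ⟨f, hf⟩ (fun g => hcomp f hf g g.2) (fun g => k ((g : X → X) x₀))
      (bdd_comp_of_compactSpace hk _)
  rw [← Measure.map_apply hfc.measurable hA, hmap]
end

section
/- Let S be a non-exceptional semigroup of polynomials that admits a left invariant mean. Then every left invariant mean on S is right invariant. -/
/-- `M` is a left invariant mean on a set `S` of polynomials, regarded as a semigroup
with product `g·h := g ∘ h` (polynomial composition):  `M (g ↦ f (h ∘ g)) = M f`. -/
def PolyLeftInv (S : Set (Polynomial ℂ)) (M : Mean S) : Prop :=
  ∀ (h : S) (hc : ∀ g : S, (h : Polynomial ℂ).comp (g : Polynomial ℂ) ∈ S),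
    ∀ f : S → ℝ, Bdd f →
      M.toFun (fun g : S => f ⟨(h : Polynomial ℂ).comp (g : Polynomial ℂ), hc g⟩) = M.toFun f

/-- `M` is a right invariant mean on a set `S` of polynomials under composition:
`M (g ↦ f (g ∘ h)) = M f`. -/
def PolyRightInv (S : Set (Polynomial ℂ)) (M : Mean S) : Prop :=
  ∀ (h : S) (hc : ∀ g : S, (g : Polynomial ℂ).comp (h : Polynomial ℂ) ∈ S),
    ∀ f : S → ℝ, Bdd f →
      M.toFun (fun g : S => f ⟨(g : Polynomial ℂ).comp (h : Polynomial ℂ), hc g⟩) = M.toFun f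

/-- The affine conjugate `σ ∘ P ∘ σ⁻¹` of `P` by `σ(z) = a z + b` (with
`σ⁻¹(z) = a⁻¹ (z - b)`), as a polynomial. -/
noncomputable def affConj (a b : ℂ) (P : Polynomial ℂ) : Polynomial ℂ :=
  ((Polynomial.C a * Polynomial.X + Polynomial.C b).comp P).comp
    (Polynomial.C a⁻¹ * (Polynomial.X - Polynomial.C b))

/-- A polynomial is exceptional if it has degree at most one, or is affinely conjugate
to the power map `z ↦ z^{deg P}` or to `± T_{deg P}` where `T_n` is the degree-`n`
Chebyshev polynomial. -/
def IsExceptional (P : Polynomial ℂ) : Prop :=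
  P.natDegree ≤ 1 ∨
  ∃ a b : ℂ, a ≠ 0 ∧
    (affConj a b P = Polynomial.X ^ P.natDegree ∨
     affConj a b P = Polynomial.Chebyshev.T ℂ (P.natDegree : ℤ) ∨
     affConj a b P = -Polynomial.Chebyshev.T ℂ (P.natDegree : ℤ))
namespace Mean

variable {σ : Type*}

theorem map_sum (M : Mean σ) {ι : Type*} (F : Finset ι) (f : ι → σ → ℝ)
    (hf : ∀ i, Bdd (f i)) :
    Bdd (∑ i ∈ F, f i) ∧ M.toFun (∑ i ∈ F, f i) = ∑ i ∈ F, M.toFun (f i) := by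
  classical
  induction F using Finset.induction_on with
  | empty =>
    have h0 : Bdd (0 : σ → ℝ) := ⟨0, fun s => by simp⟩
    have := M.map_smul' 0 0 h0
    refine ⟨by simpa using h0, by simpa using this⟩
  | insert i F hi ih =>
    rw [Finset.sum_insert hi, Finset.sum_insert hi]
    refine ⟨?_, by rw [M.map_add' _ _ (hf i) ih.1, ih.2]⟩
    obtain ⟨C, hC⟩ := hf i
    obtain ⟨D, hD⟩ := ih.1
    exact ⟨C + D, fun s => (abs_add_le _ _).trans (add_le_add (hC s) (hD s))⟩

variable [Semigroup σ]

/-- A left invariant mean forces any two principal right ideals to meet. -/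
theorem exists_mul_eq_mul (M : Mean σ)
    (hM : ∀ (h : σ) (f : σ → ℝ), Bdd f → M.toFun (fun g => f (h * g)) = M.toFun f)
    (s t : σ) : ∃ a b, s * a = t * b := by
  classical
  by_contra! hst
  let ind : σ → σ → ℝ := fun u w => if ∃ a, w = u * a then 1 else 0
  have hb : ∀ u, Bdd (ind u) := fun u => ⟨1, fun w => by
    simp only [ind]; split_ifs <;> simp⟩
  have hone : ∀ u, M.toFun (ind u) = 1 := fun u => by
    rw [← hM u (ind u) (hb u), ← M.one']
    congr 1
    funext g
    simp [ind]
  have hb1 : Bdd (fun _ : σ => (1 : ℝ)) := ⟨1, by simp⟩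
  have hbneg : ∀ u, Bdd ((-1 : ℝ) • ind u) := fun u => by
    obtain ⟨C, hC⟩ := hb u
    exact ⟨C, fun w => by simpa using hC w⟩
  have hbs : Bdd ((-1 : ℝ) • ind s + (-1 : ℝ) • ind t) := by
    obtain ⟨C, hC⟩ := hbneg s
    obtain ⟨D, hD⟩ := hbneg t
    exact ⟨C + D, fun w => (abs_add_le _ _).trans (add_le_add (hC w) (hD w))⟩
  have hbt : Bdd ((fun _ => (1 : ℝ)) + ((-1 : ℝ) • ind s + (-1 : ℝ) • ind t)) := by
    obtain ⟨C, hC⟩ := hb1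
    obtain ⟨D, hD⟩ := hbs
    exact ⟨C + D, fun w => (abs_add_le _ _).trans (add_le_add (hC w) (hD w))⟩
  have hnn := M.nonneg' _ hbt fun w => by
    simp only [Pi.add_apply, Pi.smul_apply, smul_eq_mul, ind]
    split_ifs with h1 h2 h2
    · obtain ⟨a, rfl⟩ := h1
      obtain ⟨b, hb⟩ := h2
      exact absurd hb (hst a b)
    all_goals norm_num
  rw [M.map_add' _ _ hb1 hbs, M.map_add' _ _ (hbneg s) (hbneg t), M.map_smul' _ _ (hb s),
    M.map_smul' _ _ (hb t), M.one', hone, hone] at hnn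
  norm_num at hnn

/-- In a right cancellative semigroup graded by a multiplicative degree with uniformly bounded
fibres, every left invariant mean is right invariant. -/
theorem right_invariant_of_bounded_fibres [IsRightCancelMul σ] (deg : σ → ℕ)
    (hdeg : ∀ x y, deg (x * y) = deg x * deg y) (m : ℕ)
    (hfin : ∀ d, {x | deg x = d}.Finite) (hcard : ∀ d, {x | deg x = d}.ncard ≤ m)
    (M : Mean σ)
    (hM : ∀ (h : σ) (f : σ → ℝ), Bdd f → M.toFun (fun g => f (h * g)) = M.toFun f)
    (h : σ) (f : σ → ℝ) (hf : Bdd f) :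
    M.toFun (fun g => f (g * h)) = M.toFun f := by
  classical
  let F : ℕ → Finset σ := fun d => (hfin d).toFinset
  have hF : ∀ d x, x ∈ F d ↔ deg x = d := fun d x => by simp [F]
  have hFc : ∀ d, (F d).card ≤ m := fun d => by
    rw [← Set.ncard_eq_toFinset_card _ (hfin d)]; exact hcard d
  obtain ⟨d, hd⟩ : ∃ d, ∀ e, (F e).card ≤ (F d).card := by
    have hbdd : BddAbove (Set.range fun d => (F d).card) := ⟨m, by rintro _ ⟨d, rfl⟩; exact hFc d⟩
    obtain ⟨d, hd⟩ := Nat.sSup_mem (Set.range_nonempty fun d => (F d).card) hbdd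
    refine ⟨d, fun e => ?_⟩
    have := le_csSup hbdd ⟨e, rfl⟩
    exact this.trans_eq hd.symm
  have himage : ∀ e, (F e).card = (F d).card → ∀ g,
      (F e).image (· * g) = F (e * deg g) := fun e he g => by
    refine Finset.eq_of_subset_of_card_le (fun w hw => ?_) ?_
    · obtain ⟨x, hx, rfl⟩ := Finset.mem_image.1 hw
      rw [hF] at hx ⊢
      rw [hdeg, hx]
    · rw [Finset.card_image_of_injective _ (mul_left_injective g), he]
      exact hd _
  have hsum : ∀ e, (F e).card = (F d).card → ∀ g,
      ∑ x ∈ F e, f (x * g) = ∑ w ∈ F (e * deg g), f w := fun e he g => by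
    rw [← himage e he g, Finset.sum_image fun x _ y _ hxy => mul_left_injective g hxy]
  have havg : ∀ (e : ℕ) (k : σ → ℝ), Bdd k →
      ((F e).card : ℝ) * M.toFun k = M.toFun (fun g => ∑ x ∈ F e, k (x * g)) := fun e k hk => by
    have := (M.map_sum (F e) (fun x g => k (x * g)) fun x => by
      obtain ⟨C, hC⟩ := hk; exact ⟨C, fun g => hC _⟩).2
    rw [Finset.sum_congr rfl fun x _ => hM x k hk, Finset.sum_const, nsmul_eq_mul] at this
    rw [← this]
    congr 1
    funext g
    simp
  have hpos : 0 < (F d).card :=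
    (Finset.card_pos.2 ⟨h, (hF _ _).2 rfl⟩).trans_le (hd (deg h))
  have hdh : (F (d * deg h)).card = (F d).card := by
    rw [← himage d rfl h, Finset.card_image_of_injective _ (mul_left_injective h)]
  have h1 := havg d (fun g => f (g * h)) (by obtain ⟨C, hC⟩ := hf; exact ⟨C, fun g => hC _⟩)
  have h2 := havg (d * deg h) f hf
  simp only [mul_assoc] at h1
  rw [funext fun g => (hsum d rfl (g * h)).trans (by rw [hdeg, mul_comm (deg g), ← mul_assoc])] at h1
  rw [hdh, funext fun g => hsum _ hdh g, ← h1] at h2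
  exact (mul_left_cancel₀ (by positivity) h2).symm

end Mean

namespace Polynomial

/-- Right cancellation for composition with a nonconstant polynomial. -/
theorem comp_right_cancel {R : Type*} [CommRing R] [IsDomain R] {p q r : R[X]}
    (hr : 0 < r.natDegree) (h : p.comp r = q.comp r) : p = q := by
  have h0 : (p - q).comp r = 0 := by rw [sub_comp, h, sub_self]
  rcases comp_eq_zero_iff.1 h0 with h0 | ⟨-, h0⟩
  · exact sub_eq_zero.1 h0
  · rw [h0, natDegree_C] at hr
    exact absurd hr (lt_irrefl 0)

/-- Composition factors of equal degree differ by an affine map. -/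
theorem exists_affine_of_comp_eq_comp {f k a b : ℂ[X]} (hf : 0 < f.natDegree)
    (hfk : f.natDegree = k.natDegree) (ha : 0 < a.natDegree) (hab : a.natDegree = b.natDegree)
    (h : f.comp a = k.comp b) :
    ∃ u v : ℂ, u ≠ 0 ∧ a = (C u * X + C v).comp b := by
  set n := f.natDegree with hn
  set m := a.natDegree with hm
  have ha0 : a.leadingCoeff ≠ 0 := leadingCoeff_ne_zero.2 fun h0 => by simp [hm, h0] at ha
  have hb0 : b.leadingCoeff ≠ 0 := leadingCoeff_ne_zero.2 fun h0 => by
    simp [hab, h0] at ha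
  have hf0 : f.leadingCoeff ≠ 0 := leadingCoeff_ne_zero.2 fun h0 => by simp [hn, h0] at hf
  set u := a.leadingCoeff / b.leadingCoeff with hu
  have hu0 : u ≠ 0 := div_ne_zero ha0 hb0
  have hlc : f.leadingCoeff * u ^ n = k.leadingCoeff := by
    have := congrArg leadingCoeff h
    rw [leadingCoeff_comp ha.ne', leadingCoeff_comp (hab ▸ ha.ne'), ← hfk, ← hn] at this
    rw [hu, div_pow]
    field_simp
    linear_combination this
  have hlow : ∀ (p q : ℂ[X]), p.natDegree = n → q.natDegree = m →
      (p.comp q - C p.leadingCoeff * q ^ n).natDegree ≤ (n - 1) * m := fun p q hp hq => by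
    have : p.comp q - C p.leadingCoeff * q ^ n = p.eraseLead.comp q := by
      have h1 := congrArg (fun r : ℂ[X] => r.comp q) p.eraseLead_add_C_mul_X_pow
      simp only [add_comp, mul_comp, C_comp, pow_comp, X_comp, hp] at h1
      rw [← h1, add_sub_cancel_right]
    rw [this, natDegree_comp, hq]
    exact Nat.mul_le_mul_right _ (hp ▸ eraseLead_natDegree_le p)
  have hdiff : (C f.leadingCoeff * (a ^ n - (C u * b) ^ n)).natDegree ≤ (n - 1) * m := by
    have : C f.leadingCoeff * (a ^ n - (C u * b) ^ n) =
        (k.comp b - C k.leadingCoeff * b ^ n) - (f.comp a - C f.leadingCoeff * a ^ n) := by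
      rw [← hlc, h, mul_pow]
      simp only [C_mul, C_pow]
      ring
    rw [this]
    exact (natDegree_sub_le _ _).trans (max_le (hlow k b hfk.symm hab.symm) (hlow f a rfl rfl))
  set g := ∑ i ∈ Finset.range n, a ^ i * (C u * b) ^ (n - 1 - i) with hg
  have hgc : g.coeff ((n - 1) * m) = n * a.leadingCoeff ^ (n - 1) := by
    rw [hg, finsetSum_coeff]
    have : ∀ i ∈ Finset.range n, (a ^ i * (C u * b) ^ (n - 1 - i)).coeff ((n - 1) * m)
        = a.leadingCoeff ^ (n - 1) := fun i hi => by
      have hi' : n - 1 = i + (n - 1 - i) := by have := Finset.mem_range.1 hi; omega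
      have hub : (C u * b).natDegree = m := by rw [natDegree_C_mul hu0, hab]
      have hlcub : (C u * b).leadingCoeff = a.leadingCoeff := by
        rw [leadingCoeff_mul, leadingCoeff_C, hu, div_mul_cancel₀ _ hb0]
      have hd : (a ^ i * (C u * b) ^ (n - 1 - i)).natDegree = (n - 1) * m := by
        have ha' : a ≠ 0 := leadingCoeff_ne_zero.1 ha0
        have hb' : C u * b ≠ 0 := mul_ne_zero (C_ne_zero.2 hu0) (leadingCoeff_ne_zero.1 hb0)
        rw [natDegree_mul (pow_ne_zero _ ha') (pow_ne_zero _ hb'), natDegree_pow, natDegree_pow,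
          hub, ← hm, ← add_mul, ← hi']
      rw [← hd, coeff_natDegree, leadingCoeff_mul, leadingCoeff_pow, leadingCoeff_pow, hlcub,
        ← pow_add, ← hi']
    rw [Finset.sum_congr rfl this]
    simp
  have hgc0 : g.coeff ((n - 1) * m) ≠ 0 := by
    rw [hgc]
    exact mul_ne_zero (by exact_mod_cast hf.ne') (pow_ne_zero _ ha0)
  have hgd : (n - 1) * m ≤ g.natDegree := le_natDegree_of_ne_zero hgc0
  have hg0 : g ≠ 0 := fun h0 => hgc0 (by rw [h0, coeff_zero])
  have hconst : (a - C u * b).natDegree = 0 := by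
    by_cases hz : a - C u * b = 0
    · rw [hz, natDegree_zero]
    · rw [natDegree_C_mul hf0, ← Commute.geom_sum₂_mul (Commute.all a (C u * b)) n, ← hg,
        natDegree_mul hg0 hz] at hdiff
      omega
  obtain ⟨v, hv⟩ := natDegree_eq_zero.1 hconst
  refine ⟨u, v, hu0, ?_⟩
  rw [add_comp, C_mul_comp, X_comp, C_comp, hv, add_sub_cancel]

theorem coeff_taylor_natDegree_sub_one {p : ℂ[X]} (hp : 0 < p.natDegree) (b : ℂ) :
    (taylor b p).coeff (p.natDegree - 1) =
      p.coeff (p.natDegree - 1) + p.natDegree * p.coeff p.natDegree * b := by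
  obtain ⟨k, hk⟩ : ∃ k, p.natDegree = k + 1 := ⟨p.natDegree - 1, by omega⟩
  rw [taylor_coeff, hasseDeriv_apply, sum_over_range' _ (by simp) (k + 2) (by omega), hk,
    Nat.add_sub_cancel, Finset.sum_range_succ, Finset.sum_range_succ, Finset.sum_eq_zero]
  · simp
  · intro i hi
    rw [Nat.choose_eq_zero_of_lt (Finset.mem_range.1 hi)]
    simp

/-- A polynomial that is not affinely equivalent to a power has finitely many affine symmetries. -/
theorem finite_affine_symmetries {Q : ℂ[X]} (hQ : 2 ≤ Q.natDegree)
    (hpow : ∀ q c d : ℂ, Q ≠ C q * (X - C c) ^ Q.natDegree + C d) :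
    {ρ : ℂ × ℂ | ∃ u v : ℂ, (C u * X + C v).comp Q = Q.comp (C ρ.1 * X + C ρ.2) ∧
      ρ.1 ≠ 0}.Finite := by
  set n := Q.natDegree with hn
  have hQ0 : Q.coeff n ≠ 0 := by
    rw [hn, coeff_natDegree]
    exact leadingCoeff_ne_zero.2 fun h0 => by simp [hn, h0] at hQ
  have hn0 : (n : ℂ) ≠ 0 := by exact_mod_cast (by omega : n ≠ 0)
  set c := -Q.coeff (n - 1) / (n * Q.coeff n) with hc
  set R := taylor c Q with hR
  have hRn : R.natDegree = n := natDegree_taylor Q c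
  have hRlead : R.coeff n = Q.coeff n := by rw [hR, hn, coeff_taylor_natDegree, coeff_natDegree]
  have hRsub : R.coeff (n - 1) = 0 := by
    rw [hR, hn, coeff_taylor_natDegree_sub_one (by omega), ← hn, hc]
    field_simp
    ring
  obtain ⟨i, hi0, hin, hi⟩ : ∃ i, 0 < i ∧ i < n ∧ R.coeff i ≠ 0 := by
    by_contra! hall
    refine hpow (R.coeff n) c (R.coeff 0) ?_
    have hRpow : R = C (R.coeff n) * X ^ n + C (R.coeff 0) := by
      ext i
      rw [coeff_add, coeff_C_mul, coeff_X_pow, coeff_C]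
      rcases Nat.eq_zero_or_pos i with rfl | hi0
      · rw [if_neg (by omega), if_pos rfl, mul_zero, zero_add]
      rcases lt_trichotomy i n with h | rfl | h
      · simp [hall i hi0 h, h.ne, hi0.ne']
      · simp [hi0.ne']
      · rw [coeff_eq_zero_of_natDegree_lt (hRn.trans_lt h)]
        simp [h.ne', hi0.ne']
    have hQR : Q = R.comp (X - C c) := by
      rw [hR, taylor_apply, comp_assoc]
      simp
    rw [hQR]
    conv_lhs => rw [hRpow]
    simp
  refine ((nthRoots (n - i) (1 : ℂ)).toFinset.finite_toSet.image
    fun a => (a, c - a * c)).subset ?_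
  rintro ⟨a, b⟩ ⟨u, v, huv, ha⟩
  simp only at huv ha
  have key : ∀ j, 0 < j → u * R.coeff j = (taylor (a * c + b - c) R).coeff j * a ^ j := by
    intro j hj
    have h1 : (C u * X + C v).comp R = (taylor (a * c + b - c) R).comp (C a * X) := by
      rw [hR, taylor_apply, taylor_apply, ← comp_assoc, huv, comp_assoc, comp_assoc, comp_assoc]
      congr 1
      simp
      ring
    have h2 := congrArg (fun r : ℂ[X] => r.coeff j) h1
    simpa [comp_C_mul_X_coeff, coeff_C, hj.ne'] using h2
  have hu : u = a ^ n := by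
    have h1 := key n (by omega)
    have h2 : (taylor (a * c + b - c) R).coeff n = R.coeff n := by
      rw [← hRn, coeff_taylor_natDegree, coeff_natDegree]
    rw [h2, mul_comm, hRlead] at h1
    exact mul_left_cancel₀ hQ0 h1
  have hb : a * c + b - c = 0 := by
    have h1 := key (n - 1) (by omega)
    have h2 := coeff_taylor_natDegree_sub_one (p := R) (by omega) (a * c + b - c)
    rw [hRn, hRsub, hRlead] at h2
    rw [h2, hRsub, mul_zero, zero_add] at h1
    have h3 := (mul_eq_zero.1 h1.symm).resolve_right (pow_ne_zero _ ha)
    exact (mul_eq_zero.1 h3).resolve_left (mul_ne_zero hn0 hQ0)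
  refine ⟨a, ?_, Prod.ext rfl (by simp only; linear_combination -hb)⟩
  have h1 := key i hi0
  rw [hb, taylor_zero, mul_comm, hu] at h1
  have h2 := mul_left_cancel₀ hi h1
  rw [← Nat.sub_add_cancel hin.le, pow_add] at h2
  simp only [Multiset.mem_toFinset, Finset.mem_coe]
  rw [mem_nthRoots (by omega)]
  exact mul_right_cancel₀ (pow_ne_zero i ha) (h2.trans (one_mul _).symm)

/-- If the second iterate is affinely equivalent to a power, the polynomial is conjugate to
a power. -/
theorem isExceptional_of_comp_self {P : ℂ[X]} (hP : 2 ≤ P.natDegree) {q c d : ℂ}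
    (h : P.comp P = C q * (X - C c) ^ (P.comp P).natDegree + C d) : IsExceptional P := by
  set n := P.natDegree with hn
  set N := (P.comp P).natDegree with hN
  have hNn : N = n * n := natDegree_comp
  have hN4 : 4 ≤ N := by nlinarith
  have hq : q ≠ 0 := by
    rintro rfl
    have := congrArg natDegree h
    simp only [C_0, zero_mul, zero_add, natDegree_C] at this
    omega
  have hder : derivative P * (derivative P).comp P = C (q * N) * (X - C c) ^ (N - 1) := by
    rw [← derivative_comp, h]
    simp [derivative_X_sub_C_pow, mul_assoc]
  have hunit : IsUnit (C (q * N)) :=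
    isUnit_C.2 (mul_ne_zero hq (by exact_mod_cast (by omega : N ≠ 0))).isUnit
  obtain ⟨i, -, hi⟩ := (dvd_prime_pow (prime_X_sub_C c) (N - 1)).1
    ((hunit.dvd_mul_left).1 ⟨_, hder.symm⟩)
  obtain ⟨w, hw⟩ := hi.symm
  obtain ⟨e, he, hew⟩ := isUnit_iff.1 w.isUnit
  rw [← hew] at hw
  have hP : ∃ e' f, P = C e' * (X - C c) ^ (i + 1) + C f := by
    have h0 : derivative (P - C (e / (i + 1)) * (X - C c) ^ (i + 1)) = 0 := by
      have hi1 : (i + 1 : ℂ) ≠ 0 := by exact_mod_cast i.succ_ne_zero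
      rw [derivative_sub, ← hw, derivative_C_mul, derivative_X_sub_C_pow, ← mul_assoc,
        Nat.add_sub_cancel]
      have : C (e / (i + 1)) * C ((i + 1 : ℕ) : ℂ) = C e := by
        rw [← C_mul]
        push_cast
        rw [div_mul_cancel₀ _ hi1]
      rw [this]
      ring
    obtain ⟨f, hf⟩ := natDegree_eq_zero.1 (derivative_eq_zero.1 h0)
    exact ⟨e / (i + 1), f, by rw [hf, add_sub_cancel]⟩
  obtain ⟨e', f, hP⟩ := hP
  have he' : e' ≠ 0 := by
    rintro rfl
    have := congrArg natDegree hP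
    simp only [C_0, zero_mul, zero_add, natDegree_C] at this
    omega
  have hni : n = i + 1 := by
    rw [hn, hP, natDegree_add_C, natDegree_C_mul he', natDegree_pow, natDegree_X_sub_C, mul_one]
  obtain ⟨r, hr⟩ := IsAlgClosed.exists_root (P - C c) (by
    rw [degree_sub_C (natDegree_pos_iff_degree_pos.1 (by omega))]
    exact (natDegree_pos_iff_degree_pos.1 (by omega)).ne')
  have hPr : P.eval r = c := by simpa [sub_eq_zero] using hr
  have hrc : r = c := by
    have h1 := congrArg (eval r) hder
    have h2 : (derivative P).eval c = 0 := by
      rw [← hw]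
      have hi0 : i ≠ 0 := by omega
      simp [hi0]
    simp only [eval_mul, eval_comp, hPr, h2, mul_zero, eval_pow, eval_sub, eval_X, eval_C] at h1
    have h3 := (mul_eq_zero.1 h1.symm).resolve_left
      (mul_ne_zero hq (by exact_mod_cast (by omega : N ≠ 0)))
    exact sub_eq_zero.1 (pow_eq_zero_iff (by omega) |>.1 h3)
  have hfc : f = c := by
    rw [hrc, hP] at hPr
    simpa using hPr
  rw [← hni, hfc] at hP
  obtain ⟨a, ha⟩ := IsAlgClosed.exists_pow_nat_eq e' (by omega : 0 < n - 1)
  have ha0 : a ≠ 0 := by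
    rintro rfl
    rw [zero_pow (by omega)] at ha
    exact he' ha.symm
  refine Or.inr ⟨a, -(a * c), ha0, Or.inl ?_⟩
  have hlin : (C a⁻¹ * (X - C (-(a * c)))) = C a⁻¹ * X + C c := by
    rw [C_neg, sub_neg_eq_add, mul_add, ← C_mul, inv_mul_cancel_left₀ ha0]
  rw [affConj, hlin, ← hn, hP]
  simp only [add_comp, mul_comp, C_comp, X_comp, pow_comp, sub_comp, add_sub_cancel_right,
    C_neg, C_mul, neg_comp, mul_pow, mul_add]
  have : C a * (C e' * (C a⁻¹ ^ n * X ^ n)) = X ^ n := by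
    rw [← C_pow, ← mul_assoc, ← mul_assoc, ← C_mul, ← C_mul, ← ha, ← pow_succ',
      Nat.sub_add_cancel (by omega), inv_pow, mul_inv_cancel₀ (pow_ne_zero _ ha0), C_1, one_mul]
  rw [this]
  ring

/-- If a composition-closed family in which any two elements have a common right multiple
contains a non-exceptional polynomial, then its elements of given degree are uniformly bounded in
number. -/
theorem bounded_fibres_of_common_multiples {S : Set ℂ[X]} (hdeg : ∀ p ∈ S, 0 < p.natDegree)
    (hcomp : ∀ p ∈ S, ∀ q ∈ S, p.comp q ∈ S) {P : ℂ[X]} (hPS : P ∈ S) (hP : ¬ IsExceptional P)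
    (hrev : ∀ s ∈ S, ∀ t ∈ S, ∃ a ∈ S, ∃ b ∈ S, s.comp a = t.comp b) :
    ∃ m, ∀ d, {x : S | x.1.natDegree = d}.Finite ∧ {x : S | x.1.natDegree = d}.ncard ≤ m := by
  have hP2 : 2 ≤ P.natDegree := by
    by_contra h
    exact hP (Or.inl (by omega))
  obtain ⟨Q, hQ⟩ : ∃ Q, Q = P.comp P := ⟨_, rfl⟩
  have hQS : Q ∈ S := hQ ▸ hcomp P hPS P hPS
  have hQd : Q.natDegree = P.natDegree * P.natDegree := hQ ▸ natDegree_comp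
  have hΓ := finite_affine_symmetries (Q := Q) (by nlinarith)
    fun q c d h => hP (isExceptional_of_comp_self hP2 (hQ ▸ h))
  let Γ := {ρ : ℂ × ℂ | ∃ u v : ℂ, (C u * X + C v).comp Q = Q.comp (C ρ.1 * X + C ρ.2) ∧
    ρ.1 ≠ 0}
  have haff : ∀ s ∈ S, ∀ t ∈ S, s.natDegree = t.natDegree →
      ∃ u v : ℂ, u ≠ 0 ∧ s = t.comp (C u * X + C v) := by
    intro s hs t ht hst
    obtain ⟨a, ha, b, hb, hab⟩ := hrev s hs t ht
    have hd := congrArg natDegree hab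
    rw [natDegree_comp, natDegree_comp, hst] at hd
    have hd' := Nat.eq_of_mul_eq_mul_left (hdeg t ht) hd
    obtain ⟨u, v, hu, hbv⟩ := exists_affine_of_comp_eq_comp (hdeg t ht) hst.symm (hdeg b hb)
      hd'.symm hab.symm
    refine ⟨u, v, hu, comp_right_cancel (hdeg a ha) ?_⟩
    rw [comp_assoc, ← hbv, hab]
  have hsym : ∀ s ∈ S, ∀ t ∈ S, s.natDegree = t.natDegree →
      ∃ ρ ∈ Γ, s.comp Q = (t.comp Q).comp (C ρ.1 * X + C ρ.2) := by
    intro s hs t ht hst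
    obtain ⟨u, v, hu, huv⟩ := haff s hs t ht hst
    obtain ⟨a, b, ha, hab⟩ := haff _ (hcomp s hs Q hQS) _ (hcomp t ht Q hQS)
      (by rw [natDegree_comp, natDegree_comp, hst])
    refine ⟨(a, b), ?_, hab⟩
    have h1 : t.comp (Q.comp (C a * X + C b)) = t.comp ((C u * X + C v).comp Q) := by
      rw [← comp_assoc, ← hab, huv, comp_assoc]
    have hQpos := hdeg Q hQS
    have hd1 : (Q.comp (C a * X + C b)).natDegree = Q.natDegree := by
      rw [natDegree_comp, natDegree_linear ha, mul_one]
    have hd2 : ((C u * X + C v).comp Q).natDegree = Q.natDegree := by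
      rw [natDegree_comp, natDegree_linear hu, one_mul]
    obtain ⟨u', v', -, h2⟩ := exists_affine_of_comp_eq_comp (hdeg t ht) rfl
      (hd1.symm ▸ hQpos) (hd1.trans hd2.symm) h1
    refine ⟨u' * u, u' * v + v', ?_, ha⟩
    rw [h2, ← comp_assoc]
    congr 1
    simp
    ring
  refine ⟨Γ.ncard, fun d => ?_⟩
  rcases Set.eq_empty_or_nonempty {x : S | x.1.natDegree = d} with h0 | ⟨t, ht⟩
  · simp [h0]
  have hex : ∀ s : S, ∃ ρ : ℂ × ℂ, s.1.natDegree = d →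
      ρ ∈ Γ ∧ s.1.comp Q = (t.1.comp Q).comp (C ρ.1 * X + C ρ.2) := fun s => by
    by_cases hs : s.1.natDegree = d
    · obtain ⟨ρ, h1, h2⟩ := hsym s.1 s.2 t.1 t.2 (hs.trans ht.symm)
      exact ⟨ρ, fun _ => ⟨h1, h2⟩⟩
    · exact ⟨0, fun h => absurd h hs⟩
  choose φ hφ using hex
  have hmaps : Set.MapsTo φ {x : S | x.1.natDegree = d} Γ := fun s hs => (hφ s hs).1
  have hinj : Set.InjOn φ {x : S | x.1.natDegree = d} := fun s hs s' hs' h =>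
    Subtype.ext <| comp_right_cancel (hdeg Q hQS) <| by rw [(hφ s hs).2, (hφ s' hs').2, h]
  exact ⟨Set.Finite.of_injOn hmaps hinj hΓ,
    Set.ncard_le_ncard_of_injOn φ hmaps hinj hΓ⟩

end Polynomial

/-- For a non-exceptional left amenable semigroup of (nonconstant complex) polynomials,
every left invariant mean is right invariant. -/
theorem left_invariant_mean_is_right_invariant
    (S : Set (Polynomial ℂ)) (hne : S.Nonempty)
    (hdeg : ∀ p ∈ S, 0 < p.natDegree)
    (hcomp : ∀ p ∈ S, ∀ q ∈ S, p.comp q ∈ S)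
    (hexc : ∃ P ∈ S, ¬ IsExceptional P)
    (hLA : ∃ M : Mean S, PolyLeftInv S M) :
    ∀ M : Mean S, PolyLeftInv S M → PolyRightInv S M := by
  intro M hM h hc f hf
  obtain ⟨P, hPS, hP⟩ := hexc
  let _ : Semigroup S :=
    { mul := fun p q => ⟨p.1.comp q.1, hcomp p.1 p.2 q.1 q.2⟩
      mul_assoc := fun p q r => Subtype.ext (Polynomial.comp_assoc p.1 q.1 r.1) }
  have hmul : ∀ p q : S, (p * q).1 = p.1.comp q.1 := fun _ _ => rfl
  have : IsRightCancelMul S := ⟨fun r p q hpq => Subtype.ext <|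
    Polynomial.comp_right_cancel (hdeg r.1 r.2) (congrArg Subtype.val hpq)⟩
  have hleft : ∀ (h : S) (f : S → ℝ), Bdd f → M.toFun (fun g => f (h * g)) = M.toFun f :=
    fun h f hf => hM h (fun g => hcomp h.1 h.2 g.1 g.2) f hf
  obtain ⟨m, hm⟩ := Polynomial.bounded_fibres_of_common_multiples hdeg hcomp hPS hP
    fun s hs t ht => by
      obtain ⟨a, b, hab⟩ := M.exists_mul_eq_mul hleft ⟨s, hs⟩ ⟨t, ht⟩
      exact ⟨a.1, a.2, b.1, b.2, congrArg Subtype.val hab⟩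
  exact M.right_invariant_of_bounded_fibres (fun p : S => p.1.natDegree)
    (fun p q => by rw [hmul, Polynomial.natDegree_comp]) m (fun d => (hm d).1)
    (fun d => (hm d).2) hleft h f hf
end

section
/- For every λ ∈ ℂ with λ ≠ 0 and every integer k ≥ 1, the semigroup generated under composition by the maps z ↦ λz and z ↦ z^k of ℂ is right amenable. -/
/-- The subsemigroup (under composition) of self-maps generated by a set `G`:
the smallest set containing `G` and closed under composition. -/
inductive GenSG {α : Type*} (G : Set (α → α)) : (α → α) → Prop
  | base {f : α → α} (hf : f ∈ G) : GenSG G f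
  | comp {f g : α → α} (hf : GenSG G f) (hg : GenSG G g) : GenSG G (f ∘ g)

open Filter Topology

theorem Bdd.comp {σ τ : Type*} {f : σ → ℝ} (hf : Bdd f) (e : τ → σ) : Bdd (fun t => f (e t)) :=
  hf.imp fun _ hC t => hC (e t)

theorem Bdd.add {σ : Type*} {f g : σ → ℝ} (hf : Bdd f) (hg : Bdd g) : Bdd (f + g) := by
  obtain ⟨C, hC⟩ := hf
  obtain ⟨D, hD⟩ := hg
  exact ⟨C + D, fun s => (abs_add_le _ _).trans (add_le_add (hC s) (hD s))⟩

theorem Bdd.smul {σ : Type*} {f : σ → ℝ} (hf : Bdd f) (c : ℝ) : Bdd (c • f) := by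
  obtain ⟨C, hC⟩ := hf
  refine ⟨|c| * C, fun s => ?_⟩
  simpa [abs_mul] using mul_le_mul_of_nonneg_left (hC s) (abs_nonneg c)

theorem Bdd.const {σ : Type*} (c : ℝ) : Bdd (fun _ : σ => c) := ⟨|c|, fun _ => le_rfl⟩

theorem Mean.abs_toFun_le {σ : Type*} (M : Mean σ) {f : σ → ℝ} {C : ℝ} (hC : ∀ s, |f s| ≤ C) :
    |M.toFun f| ≤ C := by
  have hf : Bdd f := ⟨C, hC⟩
  have hone : Bdd (fun _ : σ => (1 : ℝ)) := Bdd.const 1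
  have key : ∀ c : ℝ, (∀ s, 0 ≤ C + c * f s) → 0 ≤ C + c * M.toFun f := fun c h => by
    have h0 := M.nonneg' (C • (fun _ => (1 : ℝ)) + c • f) ((hone.smul C).add (hf.smul c))
      (fun s => by simpa using h s)
    rwa [M.map_add' _ _ (hone.smul C) (hf.smul c), M.map_smul' _ _ hone, M.map_smul' _ _ hf,
      M.one', mul_one] at h0
  have h₁ := key 1 fun s => by linarith [(abs_le.mp (hC s)).1]
  have h₂ := key (-1) fun s => by linarith [(abs_le.mp (hC s)).2]
  exact abs_le.mpr ⟨by linarith, by linarith⟩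

/-- Cesàro averages of a real sequence. -/
noncomputable def cesaro (f : ℕ → ℝ) (N : ℕ) : ℝ := (∑ i ∈ Finset.range N, f i) / N

theorem abs_cesaro_le {f : ℕ → ℝ} {C : ℝ} (hC : ∀ n, |f n| ≤ C) (N : ℕ) : |cesaro f N| ≤ C := by
  have hC0 : 0 ≤ C := (abs_nonneg _).trans (hC 0)
  rw [cesaro, abs_div, Nat.abs_cast]
  refine div_le_of_le_mul₀ N.cast_nonneg hC0 ?_
  calc |∑ i ∈ Finset.range N, f i| ≤ ∑ i ∈ Finset.range N, |f i| := Finset.abs_sum_le_sum_abs _ _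
    _ ≤ ∑ _i ∈ Finset.range N, C := Finset.sum_le_sum fun i _ => hC i
    _ = C * N := by simp [mul_comm]

theorem tendsto_cesaro_limUnder {f : ℕ → ℝ} (hf : Bdd f) :
    Tendsto (cesaro f) (hyperfilter ℕ) (𝓝 (limUnder (hyperfilter ℕ : Filter ℕ) (cesaro f))) := by
  obtain ⟨C, hC⟩ := hf
  obtain ⟨x, -, hx⟩ := (isCompact_Icc (a := -C) (b := C)).ultrafilter_le_nhds
    ((hyperfilter ℕ).map (cesaro f))
    (le_principal_iff.mpr (mem_map.mpr
      (Eventually.of_forall fun N => abs_le.mp (abs_cesaro_le hC N))))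
  exact tendsto_nhds_limUnder ⟨x, hx⟩

/-- The Banach limit given by ultrafilter limits of Cesàro averages. -/
noncomputable def banachLimit : Mean ℕ where
  toFun f := limUnder (hyperfilter ℕ : Filter ℕ) (cesaro f)
  map_add' f g hf hg := by
    refine Tendsto.limUnder_eq
      (((tendsto_cesaro_limUnder hf).add (tendsto_cesaro_limUnder hg)).congr fun N => ?_)
    simp [cesaro, Finset.sum_add_distrib, add_div]
  map_smul' c f hf := by
    refine Tendsto.limUnder_eq (((tendsto_cesaro_limUnder hf).const_mul c).congr fun N => ?_)
    simp [cesaro, ← Finset.mul_sum, mul_div_assoc]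
  nonneg' f hf h0 := ge_of_tendsto' (tendsto_cesaro_limUnder hf) fun N =>
    div_nonneg (Finset.sum_nonneg fun i _ => h0 i) N.cast_nonneg
  one' := by
    refine Tendsto.limUnder_eq (tendsto_const_nhds.congr' ?_)
    refine Nat.hyperfilter_le_atTop ((eventually_gt_atTop 0).mono fun N hN => ?_)
    have : (N : ℝ) ≠ 0 := by positivity
    simp [cesaro, this]

theorem banachLimit_succ {f : ℕ → ℝ} (hf : Bdd f) :
    banachLimit.toFun (fun n => f (n + 1)) = banachLimit.toFun f := by
  refine Tendsto.limUnder_eq ?_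
  have hdiff : Tendsto (fun N : ℕ => (f N - f 0) / N) (hyperfilter ℕ) (𝓝 0) := by
    refine Tendsto.mono_left ?_ Nat.hyperfilter_le_atTop
    obtain ⟨C, hC⟩ := hf
    refine squeeze_zero_norm (fun N => ?_) (tendsto_const_div_atTop_nhds_zero_nat (C + C))
    rw [Real.norm_eq_abs, abs_div, Nat.abs_cast]
    gcongr
    exact (abs_sub _ _).trans (add_le_add (hC N) (hC 0))
  have h := (tendsto_cesaro_limUnder hf).add hdiff
  rw [add_zero] at h
  refine h.congr fun N => ?_
  have hs := Finset.sum_range_succ f N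
  rw [Finset.sum_range_succ'] at hs
  rw [cesaro, cesaro, ← add_div]
  congr 1
  linarith

theorem banachLimit_add {f : ℕ → ℝ} (hf : Bdd f) (j : ℕ) :
    banachLimit.toFun (fun n => f (n + j)) = banachLimit.toFun f := by
  induction j with
  | zero => rfl
  | succ j ih =>
    rw [← ih, ← banachLimit_succ (hf.comp (· + j))]
    simp only [add_assoc, add_comm 1 j]

/-- The mean obtained by iterating two Banach limits along a doubly indexed family. -/
noncomputable def iteratedMean {σ : Type*} (e : ℕ → ℕ → σ) : Mean σ where
  toFun f := banachLimit.toFun fun n => banachLimit.toFun fun m => f (e m n)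
  map_add' f g hf hg := by
    rw [← banachLimit.map_add']
    · congr 1
      funext n
      exact banachLimit.map_add' _ _ (hf.comp _) (hg.comp _)
    · exact hf.imp fun _ hC n => banachLimit.abs_toFun_le fun m => hC (e m n)
    · exact hg.imp fun _ hC n => banachLimit.abs_toFun_le fun m => hC (e m n)
  map_smul' c f hf := by
    rw [← banachLimit.map_smul']
    · congr 1
      funext n
      exact banachLimit.map_smul' _ _ (hf.comp _)
    · exact hf.imp fun _ hC n => banachLimit.abs_toFun_le fun m => hC (e m n)
  nonneg' f hf h0 := banachLimit.nonneg' _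
    (hf.imp fun _ hC n => banachLimit.abs_toFun_le fun m => hC (e m n))
    fun n => banachLimit.nonneg' _ (hf.comp _) fun m => h0 (e m n)
  one' := by simp only [banachLimit.one']

theorem iteratedMean_shift {σ : Type*} (e : ℕ → ℕ → σ) {f : σ → ℝ} (hf : Bdd f)
    (p : ℕ → ℕ) (q : ℕ) :
    (banachLimit.toFun fun n => banachLimit.toFun fun m => f (e (m + p n) (n + q))) =
      (iteratedMean e).toFun f := by
  have h : ∀ n, (banachLimit.toFun fun m => f (e (m + p n) (n + q))) =
      banachLimit.toFun fun m => f (e m (n + q)) := fun n =>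
    banachLimit_add (hf.comp fun m => e m (n + q)) (p n)
  simp only [h]
  exact banachLimit_add (f := fun n => banachLimit.toFun fun m => f (e m n))
    (hf.imp fun _ hC n => banachLimit.abs_toFun_le fun m => hC (e m n)) q

theorem genSG_homothety_power_monomial (lam : ℂ) (k m n : ℕ) :
    GenSG {fun z : ℂ => lam * z, fun z : ℂ => z ^ k} (fun z => lam ^ (m + 1) * z ^ k ^ n) := by
  induction n with
  | zero =>
    induction m with
    | zero => exact .base (by simp)
    | succ m ih =>
      convert GenSG.comp (.base (Set.mem_insert _ _)) ih using 1
      funext z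
      simp only [Function.comp_apply]
      ring
  | succ n ih =>
    convert GenSG.comp ih (.base (Set.mem_insert_of_mem _ rfl)) using 1
    funext z
    simp only [Function.comp_apply]
    rw [← pow_mul, pow_succ' k]

theorem GenSG.exists_eq_monomial {lam : ℂ} {k : ℕ} {h : ℂ → ℂ}
    (hh : GenSG {fun z : ℂ => lam * z, fun z : ℂ => z ^ k} h) :
    ∃ p q : ℕ, h = fun z => lam ^ p * z ^ k ^ q := by
  induction hh with
  | base hf =>
    rcases hf with rfl | rfl
    · exact ⟨1, 0, by simp⟩
    · exact ⟨0, 1, by simp⟩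
  | comp _ _ ihf ihg =>
    obtain ⟨p, q, rfl⟩ := ihf
    obtain ⟨p', q', rfl⟩ := ihg
    refine ⟨p + p' * k ^ q, q' + q, funext fun z => ?_⟩
    simp only [Function.comp_apply, mul_pow, ← pow_mul, pow_add, mul_assoc]

/-- For every `λ ≠ 0` and every `k ≥ 1`, the semigroup of self-maps of `ℂ` generated
under composition by `z ↦ λz` and `z ↦ z^k` is right amenable. -/
theorem genSG_homothety_power_rightAmenable (lam : ℂ) (hlam : lam ≠ 0) (k : ℕ) (hk : 1 ≤ k) :
    ∃ M : Mean (setOf (GenSG {fun z : ℂ => lam * z, fun z : ℂ => z ^ k})),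
      MapRightInv (setOf (GenSG {fun z : ℂ => lam * z, fun z : ℂ => z ^ k})) M := by
  let e (m n : ℕ) : setOf (GenSG {fun z : ℂ => lam * z, fun z : ℂ => z ^ k}) :=
    ⟨_, genSG_homothety_power_monomial lam k m n⟩
  refine ⟨iteratedMean e, ?_⟩
  rintro ⟨h, hh⟩ hc f hf
  obtain ⟨p, q, rfl⟩ := GenSG.exists_eq_monomial hh
  rw [← iteratedMean_shift e hf (fun n => p * k ^ n) q]
  change (banachLimit.toFun fun n => banachLimit.toFun fun m => f ⟨_, hc (e m n)⟩) = _
  congr! 6 with n m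
  refine Subtype.ext (funext fun z => ?_)
  simp only [e, Function.comp_apply, mul_pow, ← pow_mul]
  ring
end

section
/- Let U be a subsemigroup of H = {z ↦ λz : λ ∈ ℂ \ {0}} and let T be a subsemigroup of Z = {z ↦ z^n : n ≥ 1} (both under composition), and let S = ⟨U, T⟩ be the semigroup they generate under composition. If U contains an element of infinite order (i.e. some z ↦ λz with λ not a root of unity) and T contains the map z ↦ z^n for some n ≥ 2, then S contains a free subsemigroup of rank 2. -/
/-- The group of homotheties `H = {z ↦ λz : λ ∈ ℂ \ {0}}`. -/
def Hset : Set (ℂ → ℂ) := {f | ∃ lam : ℂ, lam ≠ 0 ∧ f = fun z => lam * z}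

/-- The semigroup of power maps `Z = {z ↦ zⁿ : n ≥ 1}`. -/
def Zset : Set (ℂ → ℂ) := {f | ∃ n : ℕ, 1 ≤ n ∧ f = fun z => z ^ n}

/-- `S` contains a free subsemigroup of rank `k` under composition: there are
`s 0, …, s (k-1) ∈ S` such that distinct nonempty words in the `s i` give distinct
maps (injectivity of the canonical homomorphism from the free semigroup on `k`
generators). -/
def HasFreeSG {α : Type*} (S : Set (α → α)) (k : ℕ) : Prop :=
  ∃ s : Fin k → (α → α), (∀ i, s i ∈ S) ∧
    ∀ l m : List (Fin k), l ≠ [] → m ≠ [] →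
      (l.map s).foldr (· ∘ ·) id = (m.map s).foldr (· ∘ ·) id → l = m

theorem pow_injective_of_forall_pow_ne_one {M : Type*} [MonoidWithZero M]
    [IsLeftCancelMulZero M] [NoZeroDivisors M] {x : M} (hx : x ≠ 0)
    (h : ∀ k : ℕ, 1 ≤ k → x ^ k ≠ 1) : Function.Injective (fun k : ℕ => x ^ k) := by
  intro a b hab
  dsimp only at hab
  wlog hle : a ≤ b generalizing a b
  · exact (this hab.symm (by omega)).symm
  obtain ⟨k, rfl⟩ := Nat.exists_eq_add_of_le hle
  by_contra hne
  have : Nontrivial M := ⟨x, 0, hx⟩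
  refine h k (by omega) (mul_left_cancel₀ (pow_ne_zero a hx) ?_)
  rw [← pow_add, ← hab, mul_one]

/-- The number with base-`n` digits `l`, least significant first, below a leading digit `1`. -/
def wordCode (n : ℕ) (l : List (Fin 2)) : ℕ := l.foldr (fun (i : Fin 2) e => (i : ℕ) + n * e) 1

theorem wordCode_pos {n : ℕ} (hn : 2 ≤ n) (l : List (Fin 2)) : 1 ≤ wordCode n l := by
  induction l with
  | nil => exact le_rfl
  | cons i l ih =>
    have : 1 ≤ n * wordCode n l := Nat.mul_pos (by omega) ih
    simp only [wordCode, List.foldr_cons] at this ⊢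
    omega

theorem one_lt_wordCode_cons {n : ℕ} (hn : 2 ≤ n) (i : Fin 2) (l : List (Fin 2)) :
    1 < wordCode n (i :: l) := by
  have : 2 * 1 ≤ n * wordCode n l := Nat.mul_le_mul hn (wordCode_pos hn l)
  simp only [wordCode, List.foldr_cons] at this ⊢
  omega

theorem wordCode_injective {n : ℕ} (hn : 2 ≤ n) : Function.Injective (wordCode n) := by
  intro l
  induction l with
  | nil =>
    rintro (_ | ⟨j, m⟩) h
    · rfl
    · exact absurd h (one_lt_wordCode_cons hn j m).ne
  | cons i l ih =>
    rintro (_ | ⟨j, m⟩) h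
    · exact absurd h (one_lt_wordCode_cons hn i l).ne'
    · change (i : ℕ) + n * wordCode n l = j + n * wordCode n m at h
      have hmod := congrArg (· % n) h
      simp only [Nat.add_mul_mod_self_left] at hmod
      rw [Nat.mod_eq_of_lt (by omega), Nat.mod_eq_of_lt (by omega)] at hmod
      have hcode : wordCode n l = wordCode n m :=
        Nat.eq_of_mul_eq_mul_left (by omega : 0 < n) (by omega)
      rw [Fin.ext hmod, ih hcode]

theorem foldr_comp_apply_eq_pow_wordCode {M : Type*} [Monoid M] (n : ℕ) (x : M)
    (l : List (Fin 2)) :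
    (l.map fun (i : Fin 2) (z : M) => x ^ (i : ℕ) * z ^ n).foldr (· ∘ ·) id x =
      x ^ wordCode n l := by
  induction l with
  | nil => simp [wordCode]
  | cons i l ih =>
    rw [List.map_cons, List.foldr_cons, Function.comp_apply, ih, ← pow_mul, ← pow_add,
      mul_comm]
    rfl

/-- If `U` is a subsemigroup of the homotheties `H` containing an element of infinite
order (some `z ↦ λz` with `λ` not a root of unity) and `T` is a subsemigroup of the
power maps `Z` containing `z ↦ zⁿ` for some `n ≥ 2`, then the semigroup `S = ⟨U, T⟩`
generated by `U` and `T` under composition contains a free subsemigroup of rank 2. -/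
theorem genSG_union_hasFreeRankTwo (U T : Set (ℂ → ℂ)) (hU : U ⊆ Hset) (hT : T ⊆ Zset)
    (hUne : U.Nonempty) (hUcomp : ∀ f ∈ U, ∀ g ∈ U, f ∘ g ∈ U)
    (hTne : T.Nonempty) (hTcomp : ∀ f ∈ T, ∀ g ∈ T, f ∘ g ∈ T)
    (hinf : ∃ lam : ℂ, lam ≠ 0 ∧ (∀ k : ℕ, 1 ≤ k → lam ^ k ≠ 1) ∧
      (fun z : ℂ => lam * z) ∈ U)
    (hpow : ∃ n : ℕ, 2 ≤ n ∧ (fun z : ℂ => z ^ n) ∈ T) :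
    HasFreeSG (setOf (GenSG (U ∪ T))) 2 := by
  obtain ⟨lam, h0, hlam, hlamU⟩ := hinf
  obtain ⟨n, hn, hnT⟩ := hpow
  have hpowS : GenSG (U ∪ T) (fun z : ℂ => z ^ n) := .base (Or.inr hnT)
  refine ⟨fun i z => lam ^ (i : ℕ) * z ^ n, fun i => ?_, fun l m _ _ h => ?_⟩
  · change GenSG (U ∪ T) _
    fin_cases i
    · simpa using hpowS
    · simpa [Function.comp_def] using (GenSG.base (Or.inl hlamU)).comp hpowS
  · have := congrFun h lam
    rw [foldr_comp_apply_eq_pow_wordCode, foldr_comp_apply_eq_pow_wordCode] at this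
    exact wordCode_injective hn (pow_injective_of_forall_pow_ne_one h0 hlam this)
end

section
/- Let n ≥ 2 be a natural number and let λ = e^{ia} with a ∈ ℝ such that a/(2π) is irrational. Then the maps z ↦ z^n and z ↦ λ z^n of ℂ generate a free semigroup of rank 2 under composition: distinct nonempty compositional words in these two maps are distinct as maps. -/
/-- A word in the maps `z ↦ zⁿ` and `z ↦ c zⁿ` is a monomial whose coefficient is the power of `c`
with exponent the value of the word read as a sequence of base-`n` digits. -/
theorem foldr_comp_power_maps_apply {R : Type*} [CommMonoid R] (n : ℕ) (c : R)
    (l : List (Fin 2)) (z : R) :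
    (l.map ![fun z : R => z ^ n, fun z : R => c * z ^ n]).foldr (· ∘ ·) id z =
      c ^ Nat.ofDigits n (l.map Fin.val) * z ^ n ^ l.length := by
  induction l with
  | nil => simp
  | cons d l ih =>
    fin_cases d <;>
      simp [ih, Nat.ofDigits_cons, mul_pow, pow_add, ← pow_mul, pow_succ, mul_comm,
        mul_left_comm]

/-- The powers of `e^{ia}` are pairwise distinct when `a / (2π)` is irrational. -/
theorem exp_I_mul_pow_injective {a : ℝ} (ha : Irrational (a / (2 * Real.pi))) :
    Function.Injective fun k : ℕ => Complex.exp (Complex.I * (a : ℂ)) ^ k := by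
  intro j k h
  simp only [← Complex.exp_nat_mul] at h
  obtain ⟨q, hq⟩ := Complex.exp_eq_exp_iff_exists_int.mp h
  have hq' : (j : ℝ) * a = k * a + q * (2 * Real.pi) := by
    have := congrArg Complex.im hq
    simpa using this
  by_contra hjk
  have hjk' : (j : ℝ) - k ≠ 0 := sub_ne_zero.mpr (Nat.cast_injective.ne hjk)
  refine ha ⟨(q : ℚ) / ((j : ℚ) - k), ?_⟩
  push_cast
  rw [div_eq_div_iff hjk' (by positivity)]
  linarith


/-- For `n ≥ 2` and `λ = e^{ia}` with `a/(2π)` irrational, the maps `z ↦ zⁿ` and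
`z ↦ λzⁿ` of `ℂ` generate a free semigroup of rank 2 under composition: distinct
nonempty compositional words in these two maps are distinct as maps. -/
theorem power_maps_free_rank_two (n : ℕ) (hn : 2 ≤ n) (a : ℝ)
    (ha : Irrational (a / (2 * Real.pi))) :
    ∀ l m : List (Fin 2), l ≠ [] → m ≠ [] →
      (l.map ![fun z : ℂ => z ^ n,
          fun z : ℂ => Complex.exp (Complex.I * (a : ℂ)) * z ^ n]).foldr (· ∘ ·) id =
        (m.map ![fun z : ℂ => z ^ n,
          fun z : ℂ => Complex.exp (Complex.I * (a : ℂ)) * z ^ n]).foldr (· ∘ ·) id →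
      l = m := by
  intro l m _ _ h
  have hz (z : ℂ) := congrFun h z
  simp only [foldr_comp_power_maps_apply] at hz
  have hlen : l.length = m.length := by
    have h2 := congrArg norm (hz 2)
    simp only [norm_mul, norm_pow, mul_comm Complex.I, Complex.norm_exp_ofReal_mul_I, one_pow,
      one_mul, Complex.norm_ofNat] at h2
    exact Nat.pow_right_injective hn (pow_right_injective₀ two_pos (by norm_num) h2)
  have hdigits := exp_I_mul_pow_injective ha (by simpa using hz 1)
  refine List.map_injective_iff.mpr Fin.val_injective
    (Nat.ofDigits_inj_of_len_eq (b := n) (by lia) (by simpa using hlen) ?_ ?_ hdigits) <;>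
  · simp only [List.mem_map]
    rintro _ ⟨d, -, rfl⟩
    lia
end

section
/- Let S be a non-exceptional semigroup of polynomials that is right amenable and such that every right invariant mean on S is also left invariant. Then S is cancellative and contains no free subsemigroup of rank 2. -/
/-- `S` contains a free subsemigroup of rank `k` under composition: there are
`s 0, …, s (k-1) ∈ S` such that distinct nonempty words in the `s i` give distinct
polynomials (injectivity of the canonical homomorphism from the free semigroup on
`k` generators). -/
def PolyHasFreeSG (S : Set (Polynomial ℂ)) (k : ℕ) : Prop :=
  ∃ s : Fin k → Polynomial ℂ, (∀ i, s i ∈ S) ∧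
    ∀ l m : List (Fin k), l ≠ [] → m ≠ [] →
      (l.map s).foldr Polynomial.comp Polynomial.X =
        (m.map s).foldr Polynomial.comp Polynomial.X → l = m

/-- `S` is left cancellative for the product `g·h := g ∘ h`. -/
def PolyLeftCancellative (S : Set (Polynomial ℂ)) : Prop :=
  ∀ a ∈ S, ∀ b ∈ S, ∀ c ∈ S, a.comp b = a.comp c → b = c

/-- `S` is right cancellative for the product `g·h := g ∘ h`. -/
def PolyRightCancellative (S : Set (Polynomial ℂ)) : Prop :=
  ∀ a ∈ S, ∀ b ∈ S, ∀ c ∈ S, b.comp a = c.comp a → b = c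

/-- `S` is cancellative: both left and right cancellative. -/
def PolyCancellative (S : Set (Polynomial ℂ)) : Prop :=
  PolyLeftCancellative S ∧ PolyRightCancellative S

open Polynomial in
/-- Precomposition with a nonconstant polynomial is injective. -/
theorem comp_right_cancel {a b c : ℂ[X]} (ha : 0 < a.natDegree) (h : b.comp a = c.comp a) :
    b = c := by
  have h0 : (b - c).comp a = 0 := by rw [sub_comp, h, sub_self]
  rcases comp_eq_zero_iff.1 h0 with h1 | ⟨-, h2⟩
  · exact sub_eq_zero.1 h1
  · rw [h2, natDegree_C] at ha
    exact absurd ha (lt_irrefl _)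

open Polynomial in
theorem natDegree_geom_sum₂_le {p q : ℂ[X]} {n : ℕ} (hp : p.natDegree ≤ n) (hq : q.natDegree ≤ n)
    (i : ℕ) : (∑ j ∈ Finset.range i, q ^ j * p ^ (i - 1 - j)).natDegree ≤ (i - 1) * n := by
  refine natDegree_sum_le_of_forall_le _ _ fun j hj => ?_
  have hji : j + (i - 1 - j) = i - 1 := by
    have := Finset.mem_range.1 hj
    omega
  calc (q ^ j * p ^ (i - 1 - j)).natDegree
      ≤ j * n + (i - 1 - j) * n :=
        natDegree_mul_le_of_le (natDegree_pow_le_of_le j hq) (natDegree_pow_le_of_le _ hp)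
    _ = (i - 1) * n := by rw [← add_mul, hji]

open Polynomial in
theorem coeff_geom_sum₂_top {p q : ℂ[X]} {n : ℕ} (hp : p.natDegree ≤ n) (hq : q.natDegree ≤ n)
    (hpq : q.coeff n = p.coeff n) (i : ℕ) :
    (∑ j ∈ Finset.range i, q ^ j * p ^ (i - 1 - j)).coeff ((i - 1) * n) =
      i * p.coeff n ^ (i - 1) := by
  rw [finsetSum_coeff]
  have : ∀ j ∈ Finset.range i,
      (q ^ j * p ^ (i - 1 - j)).coeff ((i - 1) * n) = p.coeff n ^ (i - 1) := by
    intro j hj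
    have hji : j + (i - 1 - j) = i - 1 := by
      have := Finset.mem_range.1 hj
      omega
    have hn : (i - 1) * n = j * n + (i - 1 - j) * n := by rw [← add_mul, hji]
    rw [hn, coeff_mul_add_eq_of_natDegree_le (natDegree_pow_le_of_le j hq)
      (natDegree_pow_le_of_le _ hp), coeff_pow_of_natDegree_le hq, coeff_pow_of_natDegree_le hp,
      hpq, ← pow_add, hji]
  rw [Finset.sum_congr rfl this]
  simp

open Polynomial in
/-- The increment `y(p + r) - y(p)` is `r` times a polynomial of degree `(deg y - 1) deg p`
whenever `deg r < deg p`. -/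
theorem exists_comp_add_sub_comp {y p r : ℂ[X]} (hy : 0 < y.natDegree)
    (hr : r.natDegree < p.natDegree) :
    ∃ E : ℂ[X], E ≠ 0 ∧ E.natDegree = (y.natDegree - 1) * p.natDegree ∧
      y.comp (p + r) - y.comp p = E * r := by
  set n := p.natDegree with hn
  set d := y.natDegree with hd
  have hp0 : p.coeff n ≠ 0 := by
    rw [hn, coeff_natDegree, Ne, leadingCoeff_eq_zero]
    rintro rfl
    simp [hn] at hr
  have hq : (p + r).natDegree ≤ n := natDegree_add_le_of_degree_le le_rfl hr.le
  have hqc : (p + r).coeff n = p.coeff n := by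
    rw [coeff_add, coeff_eq_zero_of_natDegree_lt hr, add_zero]
  set G : ℕ → ℂ[X] := fun i => ∑ j ∈ Finset.range i, (p + r) ^ j * p ^ (i - 1 - j) with hG
  have hGd : ∀ i, (G i).natDegree ≤ (i - 1) * n := natDegree_geom_sum₂_le le_rfl hq
  set E : ℂ[X] := ∑ i ∈ Finset.range (d + 1), C (y.coeff i) * G i with hE
  have hEle : E.natDegree ≤ (d - 1) * n := by
    refine natDegree_sum_le_of_forall_le _ _ fun i hi => ?_
    refine (natDegree_C_mul_le _ _).trans ((hGd i).trans ?_)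
    have := Finset.mem_range.1 hi
    exact Nat.mul_le_mul_right _ (by omega)
  have hEc : E.coeff ((d - 1) * n) ≠ 0 := by
    have hlow : ∀ i ∈ Finset.range d, (C (y.coeff i) * G i).coeff ((d - 1) * n) = 0 := by
      intro i hi
      have hid := Finset.mem_range.1 hi
      rw [coeff_C_mul]
      rcases Nat.eq_zero_or_pos i with rfl | hi0
      · simp [hG]
      · have hlt : (G i).natDegree < (d - 1) * n :=
          (hGd i).trans_lt (Nat.mul_lt_mul_of_pos_right (by omega) (by omega))
        rw [coeff_eq_zero_of_natDegree_lt hlt, mul_zero]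
    rw [hE, finsetSum_coeff, Finset.sum_range_succ, Finset.sum_eq_zero hlow, zero_add, coeff_C_mul,
      coeff_geom_sum₂_top le_rfl hq hqc]
    refine mul_ne_zero ?_ (mul_ne_zero (Nat.cast_ne_zero.2 hy.ne') (pow_ne_zero _ hp0))
    rw [hd, coeff_natDegree, Ne, leadingCoeff_eq_zero]
    rintro rfl
    simp [hd] at hy
  refine ⟨E, ?_, le_antisymm hEle (le_natDegree_of_ne_zero hEc), ?_⟩
  · intro h
    simp [h] at hEc
  · have hexp : ∀ w : ℂ[X], y.comp w = ∑ i ∈ Finset.range (d + 1), C (y.coeff i) * w ^ i := by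
      intro w
      rw [comp, eval₂_eq_sum_range]
    rw [hexp, hexp, ← Finset.sum_sub_distrib, hE, Finset.sum_mul]
    refine Finset.sum_congr rfl fun i _ => ?_
    have := (Commute.all (p + r) p).geom_sum₂_mul i
    rw [add_sub_cancel_left] at this
    rw [← mul_sub, mul_assoc, this]

open Polynomial in
/-- Two right factors of the same degree of the same polynomial differ by an affine map. -/
theorem exists_affine_of_comp_eq {x y p q : ℂ[X]} (hp : 0 < p.natDegree)
    (hpq : p.natDegree = q.natDegree) (hy : 0 < y.natDegree) (h : x.comp p = y.comp q) :
    ∃ σ : ℂ[X], σ.natDegree = 1 ∧ q = σ.comp p := by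
  have hlp : p.leadingCoeff ≠ 0 := by
    rw [Ne, leadingCoeff_eq_zero]
    rintro rfl
    simp at hp
  have hlq : q.leadingCoeff ≠ 0 := by
    rw [Ne, leadingCoeff_eq_zero]
    rintro rfl
    simp [hpq] at hp
  set α := q.leadingCoeff / p.leadingCoeff with hα
  have hα0 : α ≠ 0 := div_ne_zero hlq hlp
  have hαp : (C α * p).natDegree = p.natDegree := natDegree_C_mul hα0
  set r := q - C α * p with hr
  have hq : q = C α * p + r := by rw [hr]; ring
  have hrd : r.natDegree < (C α * p).natDegree := by
    have hle : r.natDegree ≤ p.natDegree := by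
      refine (natDegree_sub_le _ _).trans ?_
      rw [hαp, ← hpq, max_self]
    have hc : r.coeff p.natDegree = 0 := by
      rw [hr, coeff_sub, coeff_C_mul, coeff_natDegree, hpq, coeff_natDegree, hα,
        div_mul_cancel₀ _ hlp, sub_self]
    rw [hαp]
    refine lt_of_le_of_ne hle fun he => ?_
    rw [← he, coeff_natDegree, leadingCoeff_eq_zero] at hc
    rw [hc, natDegree_zero] at he
    omega
  have hr0 : r.natDegree = 0 := by
    by_contra hne
    obtain ⟨E, hE0, hEd, hE⟩ := exists_comp_add_sub_comp hy hrd
    have hr0 : r ≠ 0 := by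
      intro h0
      simp [h0] at hne
    have hcomp : (x - y.comp (C α * X)).comp p = E * r := by
      rw [← hE, ← hq, sub_comp, h, comp_assoc]
      simp
    have hdeg := congrArg natDegree hcomp
    rw [natDegree_comp, natDegree_mul hE0 hr0, hEd, hαp] at hdeg
    have hdvd : p.natDegree ∣ r.natDegree :=
      (Nat.dvd_add_right (Dvd.intro_left _ rfl)).1 (Dvd.intro_left _ hdeg)
    exact absurd (Nat.le_of_dvd (Nat.pos_of_ne_zero hne) hdvd) (not_le.2 (hαp ▸ hrd))
  refine ⟨C α * X + C (r.coeff 0), natDegree_linear hα0, ?_⟩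
  rw [eq_C_of_natDegree_eq_zero hr0] at hq
  simpa using hq

open Polynomial in
theorem coeff_comp_X_add_C_of_natDegree_le {f : ℂ[X]} {m : ℕ} (hf : f.natDegree ≤ m + 1) (r : ℂ) :
    (f.comp (X + C r)).coeff m = f.coeff m + (m + 1) * f.coeff (m + 1) * r := by
  have hd : (hasseDeriv m f).natDegree < 2 := by
    have := natDegree_hasseDeriv_le f m
    omega
  rw [← taylor_apply, taylor_coeff, eval_eq_sum_range' hd]
  simp [Finset.sum_range_succ, hasseDeriv_coeff, add_comm 1 m]

open Polynomial in
/-- A polynomial of degree at least two of the form `c (z - e) ^ n + e` is exceptional. -/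
theorem isExceptional_of_comp_X_add_C {P : ℂ[X]} {e c : ℂ} (hn : 2 ≤ P.natDegree) (hc : c ≠ 0)
    (h : P.comp (X + C e) = C c * X ^ P.natDegree + C e) : IsExceptional P := by
  set n := P.natDegree
  obtain ⟨a, ha⟩ := IsAlgClosed.exists_pow_nat_eq c (show 0 < n - 1 by omega)
  have ha0 : a ≠ 0 := by
    rintro rfl
    rw [zero_pow (by omega)] at ha
    exact hc ha.symm
  refine Or.inr ⟨a, -(a * e), ha0, Or.inl ?_⟩
  refine Polynomial.funext fun w => ?_
  have hw := congrArg (eval (a⁻¹ * w)) h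
  have hpow : a ^ n = a * c := by
    rw [← ha, ← pow_succ']
    congr 1
    omega
  simp only [eval_comp, eval_add, eval_X, eval_C, eval_mul, eval_pow] at hw
  have harg : a⁻¹ * (w + a * e) = a⁻¹ * w + e := by
    field_simp
  simp only [affConj, eval_comp, eval_add, eval_sub, eval_X, eval_C, eval_mul, eval_pow,
    sub_neg_eq_add]
  rw [harg, hw, mul_pow, inv_pow, hpow]
  field_simp
  ring

open Polynomial in
/-- A set of affine maps which a non-exceptional polynomial semiconjugates into itself is finite. -/
theorem finite_of_semiconj {P : ℂ[X]} (hP : ¬ IsExceptional P) {H : Set ℂ[X]}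
    (hH : ∀ σ ∈ H, σ.natDegree = 1) (hsemi : ∀ σ ∈ H, ∃ τ ∈ H, P.comp σ = τ.comp P) :
    H.Finite := by
  have hn2 : 2 ≤ P.natDegree := by
    by_contra hlt
    exact hP (Or.inl (by omega))
  obtain ⟨m, hm⟩ : ∃ m, P.natDegree = m + 1 := ⟨P.natDegree - 1, by omega⟩
  have hl : P.coeff (m + 1) ≠ 0 := by
    rw [← hm, coeff_natDegree, Ne, leadingCoeff_eq_zero]
    rintro rfl
    simp at hn2
  have hm0 : ((m : ℂ) + 1) ≠ 0 := Nat.cast_add_one_ne_zero m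
  set e : ℂ := -(P.coeff m / ((m + 1) * P.coeff (m + 1))) with he
  set Q := P.comp (X + C e) with hQ
  have hQd : Q.natDegree = m + 1 := by
    rw [hQ, natDegree_comp, natDegree_X_add_C, mul_one, hm]
  have hQm : Q.coeff m = 0 := by
    rw [hQ, coeff_comp_X_add_C_of_natDegree_le hm.le, he]
    field_simp
    ring
  have hQl : Q.coeff (m + 1) ≠ 0 := by
    rw [← hQd, coeff_natDegree, Ne, leadingCoeff_eq_zero]
    intro h0
    rw [h0] at hQd
    simp at hQd
  have hform : ∀ σ ∈ H, ∃ α β : ℂ, α ≠ 0 ∧ σ = C α * (X - C e) + C (e + β) := by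
    intro σ hσ
    obtain ⟨a, ha, b, hab⟩ := natDegree_eq_one.1 (hH σ hσ)
    refine ⟨a, b + a * e - e, ha, ?_⟩
    rw [← hab]
    simp only [map_add, map_sub, map_mul]
    ring
  have hrel : ∀ α β : ℂ, ∀ τ : ℂ[X], P.comp (C α * (X - C e) + C (e + β)) = τ.comp P →
      Q.comp (C α * X + C β) = τ.comp Q := by
    intro α β τ hστ
    rw [hQ, ← comp_assoc, ← hστ, comp_assoc, comp_assoc]
    congr 1
    simp only [add_comp, mul_comp, sub_comp, X_comp, C_comp, map_add]
    ring
  have hfix : ∀ σ ∈ H, ∃ α : ℂ, α ≠ 0 ∧ σ = C α * (X - C e) + C e := by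
    intro σ hσ
    obtain ⟨α, β, hα, rfl⟩ := hform σ hσ
    obtain ⟨τ, hτ, hστ⟩ := hsemi _ hσ
    obtain ⟨γ, δ, hγ, rfl⟩ := hform τ hτ
    have h1 := hrel _ _ _ hστ
    have h2 : Q.comp (C α * X + C β) = (Q.comp (C α * X)).comp (X + C (β / α)) := by
      rw [comp_assoc Q]
      simp only [mul_comp, C_comp, X_comp, mul_add, ← C_mul]
      rw [mul_div_cancel₀ _ hα]
    have h3 := congrArg (fun f => coeff f m) (h2.symm.trans h1)
    have hQα : (Q.comp (C α * X)).natDegree ≤ m + 1 := by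
      rw [natDegree_comp, natDegree_C_mul_X _ hα, mul_one, hQd]
    have hm1 : m ≠ 0 := by omega
    simp only [coeff_comp_X_add_C_of_natDegree_le hQα, comp_C_mul_X_coeff, hQm, add_comp, mul_comp,
      sub_comp, C_comp, X_comp, coeff_add, coeff_C_mul, coeff_sub, coeff_C, if_neg hm1] at h3
    have hβ : β = 0 := by
      simpa [hm0, hQl, hα] using h3
    exact ⟨α, hα, by rw [hβ, add_zero]⟩
  have hcoeff : ∀ α γ : ℂ, P.comp (C α * (X - C e) + C e) = (C γ * (X - C e) + C e).comp P →
      ∀ i, i ≠ 0 → Q.coeff i * α ^ i = γ * Q.coeff i := by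
    intro α γ hαγ i hi
    have h1 := congrArg (fun f => coeff f i) (hrel α 0 (C γ * (X - C e) + C e) (by rw [add_zero, hαγ]))
    simpa [comp_C_mul_X_coeff, coeff_C, hi] using h1
  have hfin : ∀ k, 0 < k →
      {σ : ℂ[X] | ∃ α : ℂ, α ^ k = 1 ∧ σ = C α * (X - C e) + C e}.Finite := by
    intro k hk
    refine ((nthRootsFinset k (1 : ℂ)).finite_toSet.image
      fun α => C α * (X - C e) + C e).subset ?_
    rintro σ ⟨α, hα, rfl⟩
    exact ⟨α, by simpa [mem_nthRootsFinset hk] using hα, rfl⟩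
  by_cases hmid : ∃ i, i ≠ 0 ∧ i < m + 1 ∧ Q.coeff i ≠ 0
  · obtain ⟨i, hi0, him, hi⟩ := hmid
    refine (hfin (m + 1 - i) (by omega)).subset fun σ hσ => ?_
    obtain ⟨α, hα, rfl⟩ := hfix σ hσ
    obtain ⟨τ, hτ, hστ⟩ := hsemi _ hσ
    obtain ⟨γ, hγ, rfl⟩ := hfix τ hτ
    refine ⟨α, ?_, rfl⟩
    have h1 := hcoeff α γ hστ i hi0
    have h2 := hcoeff α γ hστ (m + 1) (by omega)
    rw [mul_comm γ] at h1 h2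
    have h3 := mul_left_cancel₀ hi h1
    have h4 := mul_left_cancel₀ hQl h2
    have h5 : α ^ i * α ^ (m + 1 - i) = α ^ i * 1 := by
      rw [← pow_add, mul_one, h3, ← h4]
      congr 1
      omega
    exact mul_left_cancel₀ (pow_ne_zero i hα) h5
  · push Not at hmid
    refine (hfin (m + 1) (by omega)).subset fun σ hσ => ?_
    obtain ⟨α, hα, rfl⟩ := hfix σ hσ
    obtain ⟨τ, hτ, hστ⟩ := hsemi _ hσ
    obtain ⟨γ, hγ, rfl⟩ := hfix τ hτ
    refine ⟨α, ?_, rfl⟩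
    by_contra hne
    have h2 := hcoeff α γ hστ (m + 1) (by omega)
    rw [mul_comm γ] at h2
    have h4 := mul_left_cancel₀ hQl h2
    have hev := congrArg (eval 0) (hrel α 0 (C γ * (X - C e) + C e) (by rw [add_zero, hστ]))
    simp only [eval_comp, eval_add, eval_sub, eval_mul, eval_C, eval_X, mul_zero, add_zero] at hev
    have hev' : (1 - γ) * (eval 0 Q - e) = 0 := by linear_combination hev
    have hQe : Q.coeff 0 = e := by
      rw [coeff_zero_eq_eval_zero]
      refine sub_eq_zero.1 ((mul_eq_zero.1 hev').resolve_left fun h => hne ?_)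
      rw [h4]
      exact (sub_eq_zero.1 h).symm
    refine hP (isExceptional_of_comp_X_add_C hn2 hQl (e := e) ?_)
    rw [← hQ, hm]
    ext i
    rcases Nat.eq_zero_or_pos i with rfl | hi
    · simp [hQe]
    · rw [coeff_add, coeff_C_mul, coeff_X_pow, coeff_C, if_neg hi.ne', add_zero]
      split_ifs with him
      · rw [him, mul_one]
      · rw [mul_zero]
        rcases lt_or_gt_of_ne him with hlt | hgt
        · exact hmid i hi.ne' hlt
        · exact coeff_eq_zero_of_natDegree_lt (by omega)

theorem bdd_indicator_one {σ : Type*} (D : Set σ) : Bdd (D.indicator fun _ => (1 : ℝ)) := by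
  refine ⟨1, fun s => ?_⟩
  by_cases hs : s ∈ D <;> simp [hs]

/-- Two sets of full measure for a mean intersect. -/
theorem Mean.inter_nonempty {σ : Type*} (M : Mean σ) {A B : Set σ}
    (hA : M.toFun (A.indicator fun _ => 1) = 1) (hB : M.toFun (B.indicator fun _ => 1) = 1) :
    (A ∩ B).Nonempty := by
  by_contra hAB
  rw [Set.not_nonempty_iff_eq_empty] at hAB
  have hunion : (A.indicator fun _ => (1 : ℝ)) + (B.indicator fun _ => 1) =
      (A ∪ B).indicator fun _ => 1 :=
    by rw [Set.indicator_union_of_disjoint (Set.disjoint_iff_inter_eq_empty.2 hAB)]; rfl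
  have hcompl : ((A ∪ B).indicator fun _ => (1 : ℝ)) + ((A ∪ B)ᶜ.indicator fun _ => 1) =
      fun _ => 1 := Set.indicator_self_add_compl _ _
  have h1 := M.map_add' _ _ (bdd_indicator_one A) (bdd_indicator_one B)
  have h2 := M.map_add' _ _ (bdd_indicator_one (A ∪ B)) (bdd_indicator_one (A ∪ B)ᶜ)
  have h3 := M.nonneg' _ (bdd_indicator_one (A ∪ B)ᶜ)
    fun s => Set.indicator_nonneg (fun _ _ => zero_le_one) s
  rw [hunion, hA, hB] at h1
  rw [hcompl, M.one', h1] at h2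
  linarith

/-- A right invariant mean forces any two principal left ideals to intersect. -/
theorem PolyRightInv.exists_comp_eq {S : Set (Polynomial ℂ)}
    (hcomp : ∀ p ∈ S, ∀ q ∈ S, p.comp q ∈ S) {M : Mean S} (hM : PolyRightInv S M)
    {a b : Polynomial ℂ} (ha : a ∈ S) (hb : b ∈ S) :
    ∃ x ∈ S, ∃ y ∈ S, x.comp a = y.comp b := by
  have key : ∀ h : S, M.toFun
      (Set.indicator {g : S | ∃ x ∈ S, (g : Polynomial ℂ) = x.comp h} fun _ => 1) = 1 := by
    intro h
    rw [← hM h (fun g => hcomp _ g.2 _ h.2) _ (bdd_indicator_one _)]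
    convert M.one' using 2
    funext g
    refine Set.indicator_of_mem ?_ _
    exact ⟨g, g.2, rfl⟩
  obtain ⟨g, ⟨x, hx, hgx⟩, ⟨y, hy, hgy⟩⟩ := M.inter_nonempty (key ⟨a, ha⟩) (key ⟨b, hb⟩)
  exact ⟨x, hx, y, hy, hgx.symm.trans hgy⟩

/-- A left invariant mean forces any two principal right ideals to intersect. -/
theorem PolyLeftInv.exists_comp_eq {S : Set (Polynomial ℂ)}
    (hcomp : ∀ p ∈ S, ∀ q ∈ S, p.comp q ∈ S) {M : Mean S} (hM : PolyLeftInv S M)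
    {a b : Polynomial ℂ} (ha : a ∈ S) (hb : b ∈ S) :
    ∃ x ∈ S, ∃ y ∈ S, a.comp x = b.comp y := by
  have key : ∀ h : S, M.toFun
      (Set.indicator {g : S | ∃ x ∈ S, (g : Polynomial ℂ) = (h : Polynomial ℂ).comp x}
        fun _ => 1) = 1 := by
    intro h
    rw [← hM h (fun g => hcomp _ h.2 _ g.2) _ (bdd_indicator_one _)]
    convert M.one' using 2
    funext g
    refine Set.indicator_of_mem ?_ _
    exact ⟨g, g.2, rfl⟩
  obtain ⟨g, ⟨x, hx, hgx⟩, ⟨y, hy, hgy⟩⟩ := M.inter_nonempty (key ⟨a, ha⟩) (key ⟨b, hb⟩)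
  exact ⟨x, hx, y, hy, hgx.symm.trans hgy⟩

/-- The affine maps carrying some element of `S` to an element of `S`. -/
def affineTransition (S : Set (Polynomial ℂ)) : Set (Polynomial ℂ) :=
  {σ | σ.natDegree = 1 ∧ ∃ p ∈ S, σ.comp p ∈ S}

section Reversible

variable {S : Set (Polynomial ℂ)}

theorem exists_affineTransition (hdeg : ∀ p ∈ S, 0 < p.natDegree)
    (hrev : ∀ a ∈ S, ∀ b ∈ S, ∃ x ∈ S, ∃ y ∈ S, x.comp a = y.comp b)
    {p q : Polynomial ℂ} (hp : p ∈ S) (hq : q ∈ S) (hpq : p.natDegree = q.natDegree) :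
    ∃ σ ∈ affineTransition S, q = σ.comp p := by
  obtain ⟨x, -, y, hy, hxy⟩ := hrev p hp q hq
  obtain ⟨σ, hσ, rfl⟩ := exists_affine_of_comp_eq (hdeg p hp) hpq (hdeg y hy) hxy
  exact ⟨σ, ⟨hσ, p, hp, hq⟩, rfl⟩

theorem affineTransition_semiconj (hdeg : ∀ p ∈ S, 0 < p.natDegree)
    (hcomp : ∀ p ∈ S, ∀ q ∈ S, p.comp q ∈ S)
    (hrev : ∀ a ∈ S, ∀ b ∈ S, ∃ x ∈ S, ∃ y ∈ S, x.comp a = y.comp b)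
    {q σ : Polynomial ℂ} (hq : q ∈ S) (hσ : σ ∈ affineTransition S) :
    ∃ τ ∈ affineTransition S, q.comp σ = τ.comp q := by
  obtain ⟨hσ1, p, hp, hσp⟩ := hσ
  obtain ⟨τ, hτ, h⟩ := exists_affineTransition hdeg hrev (hcomp q hq p hp) (hcomp q hq _ hσp)
    (by simp [Polynomial.natDegree_comp, hσ1])
  refine ⟨τ, hτ, comp_right_cancel (hdeg p hp) ?_⟩
  rw [Polynomial.comp_assoc, h, Polynomial.comp_assoc]

theorem affineTransition_finite (hdeg : ∀ p ∈ S, 0 < p.natDegree)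
    (hcomp : ∀ p ∈ S, ∀ q ∈ S, p.comp q ∈ S) (hexc : ∃ P ∈ S, ¬ IsExceptional P)
    (hrev : ∀ a ∈ S, ∀ b ∈ S, ∃ x ∈ S, ∃ y ∈ S, x.comp a = y.comp b) :
    (affineTransition S).Finite := by
  obtain ⟨P, hPS, hP⟩ := hexc
  exact finite_of_semiconj hP (fun σ hσ => hσ.1)
    fun σ hσ => affineTransition_semiconj hdeg hcomp hrev hPS hσ

theorem exists_forall_comp_eq_self (hne : S.Nonempty) (hcomp : ∀ p ∈ S, ∀ q ∈ S, p.comp q ∈ S)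
    (hrev : ∀ a ∈ S, ∀ b ∈ S, ∃ x ∈ S, ∃ y ∈ S, x.comp a = y.comp b)
    {K : Set (Polynomial ℂ)} (hK : K.Finite) (hinv : ∀ τ ∈ K, ∃ u ∈ S, u.comp τ = u) :
    ∃ u ∈ S, ∀ τ ∈ K, u.comp τ = u := by
  induction K, hK using Set.Finite.induction_on with
  | empty => exact hne.imp fun u hu => ⟨hu, by simp⟩
  | @insert σ K _ _ ih =>
    obtain ⟨u, hu, huK⟩ := ih fun τ hτ => hinv τ (Set.mem_insert_of_mem _ hτ)
    obtain ⟨v, hv, hvσ⟩ := hinv σ (Set.mem_insert _ _)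
    obtain ⟨x, hx, y, hy, hxy⟩ := hrev u hu v hv
    refine ⟨x.comp u, hcomp x hx u hu, ?_⟩
    rintro τ (rfl | hτ)
    · rw [hxy, Polynomial.comp_assoc, hvσ]
    · rw [Polynomial.comp_assoc, huK τ hτ]

theorem polyLeftCancellative_of_reversible (hne : S.Nonempty) (hdeg : ∀ p ∈ S, 0 < p.natDegree)
    (hcomp : ∀ p ∈ S, ∀ q ∈ S, p.comp q ∈ S)
    (hexc : ∃ P ∈ S, ¬ IsExceptional P)
    (hrev : ∀ a ∈ S, ∀ b ∈ S, ∃ x ∈ S, ∃ y ∈ S, x.comp a = y.comp b)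
    (hrev' : ∀ a ∈ S, ∀ b ∈ S, ∃ x ∈ S, ∃ y ∈ S, a.comp x = b.comp y) :
    PolyLeftCancellative S := by
  intro a ha b hb c hc habc
  have hbc : b.natDegree = c.natDegree := by
    have := congrArg Polynomial.natDegree habc
    rw [Polynomial.natDegree_comp, Polynomial.natDegree_comp] at this
    exact Nat.eq_of_mul_eq_mul_left (hdeg a ha) this
  obtain ⟨σ, hσ, rfl⟩ := exists_affineTransition hdeg hrev hb hc hbc
  obtain ⟨u, hu, huK⟩ := exists_forall_comp_eq_self (K := {τ ∈ affineTransition S |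
    ∃ u ∈ S, u.comp τ = u}) hne hcomp hrev
    ((affineTransition_finite hdeg hcomp hexc hrev).subset (Set.sep_subset _ _)) fun τ hτ => hτ.2
  obtain ⟨x, hx, y, hy, hxy⟩ := hrev' _ (hcomp b hb u hu) _ (hcomp _ hc u hu)
  have habu : (a.comp (b.comp u)) ∈ S := hcomp a ha _ (hcomp b hb u hu)
  have heq : (a.comp (b.comp u)).comp x = (a.comp (b.comp u)).comp y := by
    rw [Polynomial.comp_assoc, hxy, ← Polynomial.comp_assoc, ← Polynomial.comp_assoc a, ← habc,
      Polynomial.comp_assoc a b u]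
  have hyx : y.natDegree = x.natDegree := by
    have := congrArg Polynomial.natDegree heq
    rw [Polynomial.natDegree_comp, Polynomial.natDegree_comp (p := a.comp (b.comp u))] at this
    exact (Nat.eq_of_mul_eq_mul_left (hdeg _ habu) this).symm
  obtain ⟨τ, hτ, rfl⟩ := exists_affineTransition hdeg hrev hy hx hyx
  have hτu : u.comp τ = u := by
    refine huK τ ⟨hτ, _, habu, comp_right_cancel (hdeg y hy) ?_⟩
    rw [Polynomial.comp_assoc, heq]
  have hbuy : b.comp (u.comp y) ∈ S := hcomp b hb _ (hcomp u hu y hy)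
  have hσ1 : σ = Polynomial.X := by
    refine comp_right_cancel (hdeg _ hbuy) ?_
    rw [Polynomial.comp_assoc b, ← Polynomial.comp_assoc u, hτu] at hxy
    rw [Polynomial.X_comp]
    simpa only [Polynomial.comp_assoc] using hxy.symm
  rw [hσ1, Polynomial.X_comp]

theorem not_polyHasFreeSG_two_of_reversible (hdeg : ∀ p ∈ S, 0 < p.natDegree)
    (hcomp : ∀ p ∈ S, ∀ q ∈ S, p.comp q ∈ S)
    (hexc : ∃ P ∈ S, ¬ IsExceptional P)
    (hrev : ∀ a ∈ S, ∀ b ∈ S, ∃ x ∈ S, ∃ y ∈ S, x.comp a = y.comp b) :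
    ¬ PolyHasFreeSG S 2 := by
  rintro ⟨s, hs, hfree⟩
  set W : List (Fin 2) → Polynomial ℂ :=
    fun l => (l.map s).foldr Polynomial.comp Polynomial.X with hW
  have hcons : ∀ i l, W (i :: l) = (s i).comp (W l) := fun i l => rfl
  have happ : ∀ l m, W (l ++ m) = (W l).comp (W m) := by
    intro l m
    induction l with
    | nil => exact Polynomial.X_comp.symm
    | cons i l ih => rw [List.cons_append, hcons, hcons, ih, Polynomial.comp_assoc]
  have hmem : ∀ l, l ≠ [] → W l ∈ S := by
    intro l hl
    induction l with
    | nil => exact absurd rfl hl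
    | cons i l ih =>
      rcases eq_or_ne l [] with rfl | hl'
      · rw [hcons]
        simpa [hW] using hs i
      · exact hcomp _ (hs i) _ (ih hl')
  have hσ : ∀ i : ℕ, ∃ σ : affineTransition S,
      W (List.replicate i 0 ++ [1]) = (σ : Polynomial ℂ).comp (W ([1] ++ List.replicate i 0)) := by
    intro i
    obtain ⟨σ, hσ, h⟩ := exists_affineTransition hdeg hrev
      (hmem ([1] ++ List.replicate i 0) (by simp)) (hmem (List.replicate i 0 ++ [1]) (by simp))
      (by rw [happ, happ, Polynomial.natDegree_comp, Polynomial.natDegree_comp, mul_comm])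
    exact ⟨⟨σ, hσ⟩, h⟩
  choose σ hσ using hσ
  have := (affineTransition_finite hdeg hcomp hexc hrev).to_subtype
  obtain ⟨i, j, hij, hσij⟩ : ∃ i j : ℕ, i < j ∧ σ i = σ j := by
    obtain ⟨i, j, hij, h⟩ := Finite.exists_ne_map_eq_of_infinite σ
    rcases lt_or_gt_of_ne hij with hlt | hlt
    · exact ⟨i, j, hlt, h⟩
    · exact ⟨j, i, hlt, h.symm⟩
  obtain ⟨k, rfl⟩ : ∃ k, j = i + (k + 1) := ⟨j - i - 1, by omega⟩
  have hrel : W ((List.replicate i 0 ++ [1]) ++ List.replicate (k + 1) 0) =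
      W (List.replicate (i + (k + 1)) 0 ++ [1]) := by
    rw [happ, hσ i, hσ (i + (k + 1)), hσij, Polynomial.comp_assoc, ← happ, List.append_assoc,
      List.replicate_append_replicate]
  have hwords := hfree _ _ (by simp) (by simp) hrel
  rw [← List.replicate_append_replicate (n := i), List.append_assoc, List.append_assoc,
    List.append_cancel_left_eq, List.replicate_succ] at hwords
  simp at hwords

end Reversible

/-- Let `S` be a non-exceptional right amenable semigroup of (nonconstant complex)
polynomials such that every right invariant mean on `S` is also left invariant.
Then `S` is cancellative and contains no free subsemigroup of rank 2. -/
theorem RIM_subset_LIM_cancellative_no_free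
    (S : Set (Polynomial ℂ)) (hne : S.Nonempty)
    (hdeg : ∀ p ∈ S, 0 < p.natDegree)
    (hcomp : ∀ p ∈ S, ∀ q ∈ S, p.comp q ∈ S)
    (hexc : ∃ P ∈ S, ¬ IsExceptional P)
    (hRA : ∃ M : Mean S, PolyRightInv S M)
    (hRL : ∀ M : Mean S, PolyRightInv S M → PolyLeftInv S M) :
    PolyCancellative S ∧ ¬ PolyHasFreeSG S 2 := by
  obtain ⟨M, hM⟩ := hRA
  have hrev : ∀ a ∈ S, ∀ b ∈ S, ∃ x ∈ S, ∃ y ∈ S, x.comp a = y.comp b :=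
    fun a ha b hb => hM.exists_comp_eq hcomp ha hb
  have hrev' : ∀ a ∈ S, ∀ b ∈ S, ∃ x ∈ S, ∃ y ∈ S, a.comp x = b.comp y :=
    fun a ha b hb => (hRL M hM).exists_comp_eq hcomp ha hb
  exact ⟨⟨polyLeftCancellative_of_reversible hne hdeg hcomp hexc hrev hrev',
    fun a ha b _ c _ h => comp_right_cancel (hdeg a ha) h⟩,
    not_polyHasFreeSG_two_of_reversible hdeg hcomp hexc hrev⟩
end
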